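/- arXiv:2410.17057 — 3 statements merged into one kernel-verified Lean document; each statement's English description precedes it below -/
import Mathlib

section
/- For every n ≥ 1, the sorting class of the \underline{13}2-avoiding stack-sorting map satisfies |Sort_n(sc_{\underline{13}2})| = Σ_{i=0}^{n−1} binom(n−1, i)·C_i, where C_i is the i-th Catalan number. -/
/-- `τ` contains the vincular pattern with entries `σ` and adjacency-constraint set `A`:
there is an occurrence of the classical pattern `σ` in `τ` (a strictly increasing choice of
positions carrying entries order-isomorphic to `σ`) such that for every `a ∈ A`, the
occurrence positions corresponding to entries `a` and `a + 1` of `σ` are adjacent in `τ`.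
Classical patterns correspond to `A = ∅`. -/
def ContainsV (σ : List ℕ) (A : Set ℕ) (τ : List ℕ) : Prop :=
  ∃ f : Fin σ.length → Fin τ.length,
    StrictMono f ∧
    (∀ a b : Fin σ.length, σ.get a < σ.get b ↔ τ.get (f a) < τ.get (f b)) ∧
    ∀ a : ℕ, a ∈ A → ∀ h : a + 1 < σ.length,
      (f ⟨a + 1, h⟩ : ℕ) = (f ⟨a, Nat.lt_of_succ_lt h⟩ : ℕ) + 1

open Classical in
/-- The `σ`-avoiding stack pass: `scAux σ A stack input` where the stack is recorded
top-to-bottom; the next input element is pushed when the stack contents together with the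
new element on top avoid the vincular pattern `(σ, A)`, and otherwise the top of the stack
is popped to the output; at the end the remaining stack entries are popped to the output. -/
noncomputable def scAux (σ : List ℕ) (A : Set ℕ) : List ℕ → List ℕ → List ℕ
  | stack, [] => stack
  | [], x :: rest => scAux σ A [x] rest
  | y :: stack', x :: rest =>
    if ContainsV σ A (x :: y :: stack') then
      y :: scAux σ A stack' (x :: rest)
    else
      scAux σ A (x :: y :: stack') rest
termination_by stack input => stack.length + 2 * input.length
decreasing_by all_goals (simp only [List.length_cons, List.length_nil]; omega)

/-- The `(σ, A)`-avoiding stack-sorting map `sc_{(σ, A)}`. -/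
noncomputable def sc (σ : List ℕ) (A : Set ℕ) (τ : List ℕ) : List ℕ :=
  scAux σ A [] τ

/-- `τ` is (the one-line notation of) a permutation of `{1, …, n}`. -/
def IsPermList (n : ℕ) (τ : List ℕ) : Prop :=
  τ.Perm (List.range' 1 n)

/-- The sorting class `Sort_n(sc_{(σ, A)})`: permutations of length `n` whose image under
`sc_{(σ, A)}` avoids the classical pattern `231`. -/
def SortSet (σ : List ℕ) (A : Set ℕ) (n : ℕ) : Set (List ℕ) :=
  {τ | IsPermList n τ ∧ ¬ ContainsV [2, 3, 1] ∅ (sc σ A τ)}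


namespace S132
open PowerSeries

def mv (w : List Bool) (i : ℕ) : List Bool :=
  w.take i ++ (decide (i = 0) :: (w.drop i).takeWhile (fun b => b))

def hh : ℕ → List Bool → ℕ
  | 0, _ => 1
  | N+1, w => ∑ i ∈ Finset.range w.length, if w[i]? = some true then hh N (mv w i) else 0

def ff : ℕ → List Bool → ℕ
  | 0, _ => 1
  | N+1, w => ∑ i ∈ Finset.range (w.length + 1),
      if w[i]? ≠ some false then ff N (mv w i) else 0

lemma mv_append_false (w r : List Bool) (i : ℕ) (hi : i < w.length) :
    mv (w ++ false :: r) i = mv w i := by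
  unfold mv
  rw [List.take_append_of_le_length hi.le, List.drop_append_of_le_length hi.le]
  congr 2
  rw [List.takeWhile_append]
  split_ifs with h
  · simp
    have := (List.takeWhile_prefix (fun b : Bool => b) (l := List.drop i w)).eq_of_length h
    rw [this]
  · rfl

lemma hh_append_false (N : ℕ) (w : List Bool) : hh N (w ++ [false]) = hh N w := by
  cases N with
  | zero => rfl
  | succ N =>
    simp only [hh, List.length_append, List.length_singleton, Finset.sum_range_succ]
    simp
    apply Finset.sum_congr rfl
    intro i hi
    have hi := Finset.mem_range.1 hi
    rw [mv_append_false _ _ _ hi, List.getElem?_append_left hi]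

lemma mv_length (w : List Bool) (hw : w ≠ []) : mv w w.length = w ++ [false] := by
  simp [mv, hw]

lemma mv_ne_nil (w : List Bool) (i : ℕ) : mv w i ≠ [] := by simp [mv]

lemma ff_eq (N : ℕ) (w : List Bool) (hw : w ≠ []) :
    ff N w = ∑ i ∈ Finset.range (N + 1), N.choose i * hh i w := by
  induction N generalizing w with
  | zero => simp [ff, hh]
  | succ N ih =>
    rw [ff, Finset.sum_range_succ]
    simp only [ne_eq, List.getElem?_eq_none (le_refl w.length)]
    simp only [mv_length w hw, reduceCtorEq, not_false_eq_true, if_true]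
    rw [ih (w ++ [false]) (by simp)]
    simp only [hh_append_false]
    have h1 : (∑ i ∈ Finset.range w.length, if ¬ w[i]? = some false then ff N (mv w i) else 0)
        = ∑ j ∈ Finset.range (N + 1), N.choose j * hh (j+1) w := by
      simp only [hh, Finset.mul_sum]
      rw [Finset.sum_comm]
      apply Finset.sum_congr rfl
      intro i hi
      have hi := Finset.mem_range.1 hi
      rw [List.getElem?_eq_getElem hi]
      cases h : w[i]
      · simp
      · simp [ih _ (mv_ne_nil w i)]
    rw [h1, Finset.sum_range_succ' (n := N + 1)]
    simp only [Nat.choose_succ_succ, add_mul, Finset.sum_add_distrib]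
    rw [Finset.sum_range_succ (fun x => N.choose (x+1) * hh (x+1) w) N]
    rw [Finset.sum_range_succ' (fun x => N.choose x * hh x w) N]
    simp
    ring

noncomputable def cc : ℕ → PowerSeries ℤ
  | a => (1 + X * ∑ i : Fin a, cc (a - 1 - i) * cc i) * PowerSeries.mk (fun _ => (1:ℤ))
termination_by a => a
decreasing_by all_goals omega

lemma geom {R : Type*} [CommRing R] (r : R) :
    (PowerSeries.mk (fun k => r ^ k)) * (1 - PowerSeries.C r * X) = 1 := by
  ext k
  rw [mul_sub, mul_one, map_sub, ← mul_assoc, mul_comm _ (C r), mul_assoc, coeff_C_mul]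
  cases k with
  | zero => simp
  | succ k => simp [coeff_succ_mul_X, coeff_one, pow_succ, mul_comm]

lemma cc_eq (a : ℕ) :
    cc a = 1 + X * (cc a + ∑ i ∈ Finset.range a, cc (a - 1 - i) * cc i) := by
  have h := geom (1 : ℤ)
  simp only [one_pow, map_one, one_mul] at h
  have h2 : cc a = (1 + X * ∑ i ∈ Finset.range a, cc (a - 1 - i) * cc i) *
      PowerSeries.mk (fun _ => (1:ℤ)) := by
    conv_lhs => rw [cc]
    rw [Finset.sum_range (fun i => cc (a - 1 - i) * cc i)]
  generalize (∑ i ∈ Finset.range a, cc (a - 1 - i) * cc i) = s at *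
  linear_combination (1 - X) * h2 + (1 + X * s) * h

noncomputable def HH (w : List Bool) : PowerSeries ℤ := PowerSeries.mk (fun N => (hh N w : ℤ))

lemma HH_eq (w : List Bool) : HH w = 1 + X * ∑ i ∈ Finset.range w.length,
    if w[i]? = some true then HH (mv w i) else 0 := by
  ext N
  cases N with
  | zero => simp [HH, hh]
  | succ N =>
    simp only [map_add, coeff_succ_X_mul, map_sum]
    simp only [HH, coeff_mk, hh, coeff_one]
    simp
    apply Finset.sum_congr rfl
    intro i _
    split_ifs <;> simp

lemma HH_append_false (w : List Bool) : HH (w ++ [false]) = HH w := by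
  ext N; simp [HH, hh_append_false]

lemma mv_rep (u : List Bool) (j k : ℕ) (h : u ≠ [] ∨ j ≠ 0) :
    mv (u ++ List.replicate (j + k) true) (u.length + j)
      = u ++ List.replicate j true ++ false :: List.replicate k true := by
  have h0 : ¬ (u.length + j = 0) := by
    rcases h with h | h
    · have := List.length_pos_iff.2 h; omega
    · omega
  have e : u ++ List.replicate (j + k) true
      = (u ++ List.replicate j true) ++ List.replicate k true := by
    rw [List.replicate_add, List.append_assoc]
  have l : u.length + j = (u ++ List.replicate j true).length := by simp
  unfold mv
  rw [e, decide_eq_false h0, l, List.take_left, List.drop_left]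
  simp

lemma HH_sep (u : List Bool) (hu : u ≠ []) (a : ℕ) :
    HH (u ++ false :: List.replicate (a+1) true) =
      HH u + X * ∑ j ∈ Finset.range (a+1),
        HH (u ++ false :: List.replicate j true ++ false :: List.replicate (a + 1 - j) true) := by
  rw [HH_eq, HH_eq u, add_assoc, ← mul_add]
  congr 2
  have : (u ++ false :: List.replicate (a+1) true).length = (u.length + 1) + (a + 1) := by
    simp; omega
  rw [this, Finset.sum_range_add, Finset.sum_range_succ]
  have e0 : (u ++ false :: List.replicate (a+1) true)[u.length]? = some false := by simp
  rw [e0]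
  simp only [Option.some.injEq, Bool.false_eq_true, if_false, add_zero]
  congr 1
  · apply Finset.sum_congr rfl
    intro i hi
    have hi := Finset.mem_range.1 hi
    rw [mv_append_false _ _ _ hi, List.getElem?_append_left hi]
  · apply Finset.sum_congr rfl
    intro j hj
    have hj := Finset.mem_range.1 hj
    have e1 : (u ++ false :: List.replicate (a+1) true)[u.length + 1 + j]? = some true := by
      rw [List.getElem?_append_right (by omega)]
      have : u.length + 1 + j - u.length = j + 1 := by omega
      rw [this]
      simp [hj]
    rw [e1, if_pos rfl]
    have := mv_rep (u ++ [false]) j (a + 1 - j) (by simp)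
    rw [show j + (a + 1 - j) = a + 1 by omega] at this
    simp at this ⊢
    rw [this]

lemma HH_dvd (N : ℕ) : ∀ (u : List Bool), u ≠ [] → ∀ a,
    (X : PowerSeries ℤ) ^ N ∣ HH (u ++ false :: List.replicate (a+1) true) - cc a * HH u := by
  induction N with
  | zero => intros; simp
  | succ N ih =>
    intro u hu a
    rw [HH_sep u hu, Finset.sum_range_succ']
    have h0 := ih (u ++ [false]) (by simp) a
    rw [HH_append_false] at h0
    have e : HH u + X * (∑ k ∈ Finset.range a,
          HH (u ++ false :: List.replicate (k + 1) true ++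
            false :: List.replicate (a + 1 - (k + 1)) true) +
        HH (u ++ false :: List.replicate 0 true ++ false :: List.replicate (a + 1 - 0) true)) -
        cc a * HH u
        = X * ((HH (u ++ [false] ++ false :: List.replicate (a+1) true) - cc a * HH u) +
          ∑ k ∈ Finset.range a,
          (HH (u ++ false :: List.replicate (k + 1) true ++
            false :: List.replicate (a + 1 - (k + 1)) true) - cc (a - 1 - k) * cc k * HH u)) := by
      rw [Finset.sum_sub_distrib, ← Finset.sum_mul]
      simp only [List.replicate_zero, Nat.sub_zero]
      linear_combination (- HH u) * cc_eq a
    rw [e, pow_succ']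
    apply mul_dvd_mul_left
    apply dvd_add h0
    apply Finset.dvd_sum
    intro k hk
    have hk := Finset.mem_range.1 hk
    have h1 := ih (u ++ false :: List.replicate (k + 1) true) (by simp) (a - 1 - k)
    have h2 := ih u hu k
    rw [show a - 1 - k + 1 = a + 1 - (k+1) by omega] at h1
    have := dvd_add h1 (Dvd.dvd.mul_left h2 (cc (a - 1 - k)))
    convert this using 1
    ring

lemma eq_of_dvd (f g : PowerSeries ℤ) (h : ∀ N, (X : PowerSeries ℤ) ^ N ∣ f - g) : f = g := by
  ext n
  have := X_pow_dvd_iff.1 (h (n+1)) n (by omega)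
  rw [map_sub] at this
  linarith

lemma HH_false (u : List Bool) (hu : u ≠ []) (a : ℕ) :
    HH (u ++ false :: List.replicate (a+1) true) = cc a * HH u :=
  eq_of_dvd _ _ fun N => HH_dvd N u hu a

lemma HH_rep (k : ℕ) : HH (List.replicate (k+1) true) =
    1 + X * (HH (List.replicate (k+2) true) +
      ∑ j ∈ Finset.range k, cc (k - 1 - j) * HH (List.replicate (j+1) true)) := by
  rw [HH_eq]
  congr 2
  rw [List.length_replicate, Finset.sum_range_succ', add_comm]
  congr 1
  · simp [mv]; rfl
  · apply Finset.sum_congr rfl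
    intro j hj
    have hj := Finset.mem_range.1 hj
    rw [if_pos (by simp [hj])]
    have h := mv_rep [] (j+1) (k - 1 - j + 1) (by simp)
    rw [show j + 1 + (k - 1 - j + 1) = k + 1 by omega] at h
    simp only [List.nil_append, List.length_nil, zero_add] at h
    rw [h, HH_false _ (by simp)]

noncomputable def Cat : PowerSeries ℤ := PowerSeries.mk (fun n => (catalan n : ℤ))

lemma Cat_eq : Cat = 1 + X * Cat ^ 2 := by
  have h := congrArg (PowerSeries.map (Nat.castRingHom ℤ)) PowerSeries.catalanSeries_sq_mul_X_add_one
  have e : PowerSeries.map (Nat.castRingHom ℤ) PowerSeries.catalanSeries = Cat := by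
    ext n; simp [Cat]
  rw [map_add, map_mul, map_pow, e] at h
  simp at h
  linear_combination -h

noncomputable def c2 : PowerSeries (PowerSeries ℤ) := PowerSeries.mk cc
noncomputable def e2 : PowerSeries (PowerSeries ℤ) :=
  C Cat * (1 - X - X^2 * c2) * PowerSeries.mk (fun k => (Cat + 1)^k)

lemma coeff_conv (f g : ℕ → PowerSeries ℤ) (k : ℕ) :
    coeff (k) (X * (PowerSeries.mk f * PowerSeries.mk g)) =
      ∑ i ∈ Finset.range k, f (k - 1 - i) * g i := by
  cases k with
  | zero => simp
  | succ k =>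
    rw [coeff_succ_X_mul, mul_comm, coeff_mul, Finset.Nat.sum_antidiagonal_eq_sum_range_succ_mk]
    apply Finset.sum_congr rfl
    intro i _
    simp [mul_comm]

lemma c2_eq : c2 = PowerSeries.mk (fun _ => 1) + C X * (c2 + X * (c2 * c2)) := by
  ext1 k
  rw [map_add, coeff_C_mul, map_add]
  unfold c2
  rw [coeff_conv, coeff_mk, coeff_mk]
  exact cc_eq k

lemma e2_eq : (X - C X - C X * X^2 * c2) * e2 = X * PowerSeries.mk (fun _ => 1) - C (X * Cat) := by
  have h1 := geom (1 : PowerSeries ℤ)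
  simp only [one_pow, map_one, one_mul] at h1
  have h2 := geom (Cat + 1)
  have hc := c2_eq
  have hC := congrArg (C : PowerSeries ℤ →+* _) Cat_eq
  unfold e2
  simp only [map_add, map_mul, map_pow, map_one] at *
  generalize (PowerSeries.mk fun k => (Cat + 1)^k) = D at *
  generalize (PowerSeries.mk fun _ => (1 : PowerSeries ℤ)) = N at *
  generalize c2 = c at *
  generalize (C Cat : PowerSeries (PowerSeries ℤ)) = K at *
  generalize (C X : PowerSeries (PowerSeries ℤ)) = x at *
  generalize (X : PowerSeries (PowerSeries ℤ)) = u at *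
  -- multiply by (1-u)(1-(K+1)u)
  have key : (u - x - x * u^2 * c) * (K * (1 - u - u^2 * c)) * (1 - u) =
      (u - x * K * (1 - u)) * (1 - (K + 1) * u) := by
    linear_combination (K * u^3 * (1-u)) * (-hc) + (K*u^3) * (-h1) + (u - u^2) * hC
  have e : (u - x - x * u ^ 2 * c) * (K * (1 - u - u ^ 2 * c) * D) =
     N * D * ((u - x - x * u^2 * c) * (K * (1 - u - u^2 * c)) * (1 - u)) := by
    linear_combination (-(u - x - x * u ^ 2 * c) * (K * (1 - u - u ^ 2 * c) * D)) * h1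
  rw [e, key]
  linear_combination N * (u - x * K * (1 - u)) * h2 - x * K * h1

lemma e2_zero : coeff 0 e2 = Cat := by
  simp [e2]

lemma e2_rec (k : ℕ) : coeff k e2 = 1 + X * (coeff (k+1) e2 +
    ∑ j ∈ Finset.range k, cc (k - 1 - j) * coeff j e2) := by
  have h := congrArg (coeff (k+1)) e2_eq
  have e : (X - C X - C X * X^2 * c2) * e2 =
     X * e2 - C X * e2 - C X * (X * (X * (PowerSeries.mk cc * PowerSeries.mk (fun i => coeff i e2)))) := by
    have : PowerSeries.mk (fun i => coeff i e2) = e2 := by ext1 i; simp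
    rw [this, c2]; ring
  rw [e] at h
  simp only [map_sub, coeff_succ_X_mul, coeff_C_mul, coeff_conv, coeff_mk] at h
  rw [coeff_C, if_neg (by omega)] at h
  linear_combination h

lemma HH_one : HH [true] = Cat := by
  have key : ∀ N k, (X : PowerSeries ℤ) ^ N ∣ HH (List.replicate (k+1) true) - coeff k e2 := by
    intro N
    induction N with
    | zero => intros; simp
    | succ N ih =>
      intro k
      rw [HH_rep, e2_rec, pow_succ', add_sub_add_left_eq_sub, ← mul_sub]
      apply mul_dvd_mul_left
      rw [add_sub_add_comm, ← Finset.sum_sub_distrib]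
      apply dvd_add (ih _)
      apply Finset.dvd_sum
      intro j _
      rw [← mul_sub]
      exact Dvd.dvd.mul_left (ih j) _
  rw [← e2_zero]
  exact eq_of_dvd _ _ fun N => key N 0

lemma ff_nil (n : ℕ) : ff (n+1) [] = ∑ i ∈ Finset.range (n+1), n.choose i * catalan i := by
  have : ff (n+1) [] = ff n [true] := by simp [ff, mv]
  rw [this, ff_eq _ _ (by simp)]
  apply Finset.sum_congr rfl
  intro i _
  congr 1
  have := congrArg (coeff i) HH_one
  simp [HH, Cat] at this
  exact this

end S132

namespace S132

abbrev Cont (l : List ℕ) : Prop := ContainsV [1, 3, 2] {0} l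
abbrev C231 (l : List ℕ) : Prop := ContainsV [2, 3, 1] ∅ l

lemma cont_iff (l : List ℕ) : Cont l ↔ ∃ i j, ∃ (h : i + 1 < j) (hj : j < l.length),
    l[i] < l[j] ∧ l[j] < l[i+1] := by
  constructor
  · rintro ⟨f, hf, ho, ha⟩
    have h1 := ha 0 (by simp) (by simp)
    have h12 : f ⟨1, by simp⟩ < f ⟨2, by simp⟩ := hf (by simp [Fin.lt_def])
    have o1 := (ho ⟨0, by simp⟩ ⟨2, by simp⟩).1 (by simp)
    have o2 := (ho ⟨2, by simp⟩ ⟨1, by simp⟩).1 (by simp)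
    have h12' : (f ⟨1, by simp⟩ : ℕ) < f ⟨2, by simp⟩ := h12
    simp only [Nat.zero_add] at h1
    refine ⟨f ⟨0, by simp⟩, f ⟨2, by simp⟩, by omega, (f ⟨2, by simp⟩).2, ?_, ?_⟩
    · simpa using o1
    · simp only [← h1]
      simpa using o2
  · rintro ⟨i, j, h, hj, h1, h2⟩
    refine ⟨![⟨i, by omega⟩, ⟨i+1, by omega⟩, ⟨j, hj⟩], ?_, ?_, ?_⟩
    · intro a b hab
      fin_cases a <;> fin_cases b <;> simp_all [Fin.lt_def] <;> omega
    · intro a b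
      fin_cases a <;> fin_cases b <;> simp <;> omega
    · intro a ha hh
      simp at ha
      subst ha
      simp

lemma cont_nil : ¬ Cont [] := by
  rw [cont_iff]; rintro ⟨i, j, h, hj, -⟩; simp at hj

lemma cont_cons (a : ℕ) (l : List ℕ) : Cont (a :: l) ↔
    (∃ y l' b, l = y :: l' ∧ b ∈ l' ∧ a < b ∧ b < y) ∨ Cont l := by
  constructor
  · rw [cont_iff]
    rintro ⟨i, j, h, hj, h1, h2⟩
    cases i with
    | zero =>
      left
      obtain ⟨j, rfl⟩ : ∃ k, j = k + 2 := ⟨j - 2, by omega⟩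
      cases l with
      | nil => simp at hj
      | cons y l' =>
        simp at hj h1 h2
        exact ⟨y, l', l'[j], rfl, by simp, h1, h2⟩
    | succ i =>
      right
      obtain ⟨j, rfl⟩ : ∃ k, j = k + 1 := ⟨j - 1, by omega⟩
      rw [cont_iff]
      simp at hj h1 h2
      exact ⟨i, j, by omega, hj, h1, h2⟩
  · rintro (⟨y, l', b, rfl, hb, h1, h2⟩ | h)
    · obtain ⟨j, hj, rfl⟩ := List.getElem_of_mem hb
      rw [cont_iff]
      exact ⟨0, j + 2, by omega, by simp; omega, by simpa using h1, by simpa using h2⟩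
    · rw [cont_iff] at *
      obtain ⟨i, j, h, hj, h1, h2⟩ := h
      exact ⟨i+1, j+1, by omega, by simp; omega, by simpa using h1, by simpa using h2⟩

lemma cont_map (f : ℕ → ℕ) (hf : StrictMono f) (l : List ℕ) : Cont (l.map f) ↔ Cont l := by
  rw [cont_iff, cont_iff]
  simp [hf.lt_iff_lt]

lemma c231_iff (l : List ℕ) : C231 l ↔ ∃ a b c, [a, b, c].Sublist l ∧ c < a ∧ a < b := by
  constructor
  · rintro ⟨f, hf, ho, -⟩
    refine ⟨l.get (f ⟨0, by simp⟩), l.get (f ⟨1, by simp⟩), l.get (f ⟨2, by simp⟩), ?_,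
      (ho ⟨2, by simp⟩ ⟨0, by simp⟩).1 (by simp), (ho ⟨0, by simp⟩ ⟨1, by simp⟩).1 (by simp)⟩
    rw [List.sublist_iff_exists_fin_orderEmbedding_get_eq]
    refine ⟨OrderEmbedding.ofStrictMono f hf, ?_⟩
    intro i
    match i with
    | ⟨0, _⟩ => rfl
    | ⟨1, _⟩ => rfl
    | ⟨2, _⟩ => rfl
  · rintro ⟨a, b, c, hs, h1, h2⟩
    rw [List.sublist_iff_exists_fin_orderEmbedding_get_eq] at hs
    obtain ⟨f, hf⟩ := hs
    have f0 := hf ⟨0, by simp⟩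
    have f1 := hf ⟨1, by simp⟩
    have f2 := hf ⟨2, by simp⟩
    simp at f0 f1 f2
    refine ⟨f, f.strictMono, ?_, by simp⟩
    intro i j
    match i, j with
    | ⟨0, _⟩, ⟨0, _⟩ => simp
    | ⟨1, _⟩, ⟨1, _⟩ => simp
    | ⟨2, _⟩, ⟨2, _⟩ => simp
    | ⟨0, _⟩, ⟨1, _⟩ => simp; rw [← f0, ← f1]; omega
    | ⟨0, _⟩, ⟨2, _⟩ => simp; rw [← f0, ← f2]; omega
    | ⟨1, _⟩, ⟨0, _⟩ => simp; rw [← f0, ← f1]; omega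
    | ⟨1, _⟩, ⟨2, _⟩ => simp; rw [← f2, ← f1]; omega
    | ⟨2, _⟩, ⟨0, _⟩ => simp; rw [← f0, ← f2]; omega
    | ⟨2, _⟩, ⟨1, _⟩ => simp; rw [← f2, ← f1]; omega

open Classical in
noncomputable def pp (x : ℕ) : List ℕ → List ℕ × List ℕ
  | [] => ([], [x])
  | y :: s => if Cont (x :: y :: s) then (y :: (pp x s).1, (pp x s).2) else ([], x :: y :: s)

lemma pp_not {x : ℕ} {s : List ℕ} (h : ¬ Cont (x :: s)) : pp x s = ([], x :: s) := by
  cases s with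
  | nil => rfl
  | cons y s => rw [pp, if_neg h]

lemma pp_cont {x y : ℕ} {s : List ℕ} (h : Cont (x :: y :: s)) :
    pp x (y :: s) = (y :: (pp x s).1, (pp x s).2) := by
  rw [pp, if_pos h]

lemma pp_perm (x : ℕ) (s : List ℕ) : ((pp x s).1 ++ (pp x s).2).Perm (x :: s) := by
  induction s with
  | nil => simp [pp]
  | cons y s ih =>
    by_cases h : Cont (x :: y :: s)
    · rw [pp_cont h]
      exact (ih.cons y).trans (List.Perm.swap _ _ _)
    · rw [pp_not h]; simp

lemma scAux_cons (s : List ℕ) (x : ℕ) (r : List ℕ) :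
    scAux [1,3,2] {0} s (x :: r) = (pp x s).1 ++ scAux [1,3,2] {0} (pp x s).2 r := by
  induction s with
  | nil => rw [scAux]; simp [pp]
  | cons y s ih =>
    rw [scAux]
    by_cases h : Cont (x :: y :: s)
    · rw [if_pos h, pp_cont h, ih]; simp
    · rw [if_neg h, pp_not h]; simp

noncomputable def stp (c : List ℕ × List ℕ) (x : ℕ) : List ℕ × List ℕ :=
  (c.1 ++ (pp x c.2).1, (pp x c.2).2)

noncomputable def rn (τ : List ℕ) : List ℕ × List ℕ := τ.foldl stp ([], [])

lemma rn_append (τ : List ℕ) (x : ℕ) : rn (τ ++ [x]) = stp (rn τ) x := by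
  simp [rn, List.foldl_append]

lemma foldl_sc (τ : List ℕ) (O s : List ℕ) :
    (τ.foldl stp (O, s)).1 ++ (τ.foldl stp (O, s)).2 = O ++ scAux [1,3,2] {0} s τ := by
  induction τ generalizing O s with
  | nil => cases s <;> simp [scAux]
  | cons x τ ih =>
    rw [List.foldl_cons, scAux_cons, stp, ih, List.append_assoc]

lemma sc_eq (τ : List ℕ) : sc [1,3,2] {0} τ = (rn τ).1 ++ (rn τ).2 := by
  rw [rn, foldl_sc]; rfl

lemma rn_perm (τ : List ℕ) : ((rn τ).1 ++ (rn τ).2).Perm τ := by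
  induction τ using List.reverseRecOn with
  | nil => simp [rn]
  | append_singleton τ x ih =>
    rw [rn_append, stp, List.append_assoc]
    refine ((pp_perm x _).append_left _).trans ?_
    refine List.perm_middle.trans ?_
    exact (ih.cons x).trans (List.perm_append_singleton _ _).symm

lemma pp_map (f : ℕ → ℕ) (hf : StrictMono f) (x : ℕ) (s : List ℕ) :
    pp (f x) (s.map f) = ((pp x s).1.map f, (pp x s).2.map f) := by
  induction s with
  | nil => simp [pp]
  | cons y s ih =>
    have e := cont_map f hf (x :: y :: s)
    by_cases h : Cont (x :: y :: s)
    · have h' := e.2 h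
      simp only [List.map_cons] at *
      rw [pp_cont h, pp_cont h', ih]; simp
    · have h' := mt e.1 h
      simp only [List.map_cons] at *
      rw [pp_not h, pp_not h']; simp

lemma rn_map (f : ℕ → ℕ) (hf : StrictMono f) (τ : List ℕ) :
    rn (τ.map f) = ((rn τ).1.map f, (rn τ).2.map f) := by
  induction τ using List.reverseRecOn with
  | nil => simp [rn]
  | append_singleton τ x ih =>
    rw [List.map_append, List.map_singleton, rn_append, ih, rn_append]
    simp [stp, pp_map f hf]

/-! pop lemmas -/

lemma not_cont_TM (T M : List ℕ) (hT : T.Pairwise (· > ·)) (hM : M.Pairwise (· < ·)) :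
    ¬ Cont (T ++ M) := by
  induction T with
  | nil =>
    induction M with
    | nil => exact cont_nil
    | cons m M ih =>
      rw [List.pairwise_cons] at hM
      simp only [List.nil_append] at *
      rw [cont_cons]
      rintro (⟨y, l', b, rfl, hb, h1, h2⟩ | h)
      · have := (List.pairwise_cons.1 hM.2).1 b hb
        omega
      · exact ih hM.2 h
  | cons t T ih =>
    rw [List.pairwise_cons] at hT
    rw [List.cons_append, cont_cons]
    rintro (⟨y, l', b, e, hb, h1, h2⟩ | h)
    · cases T with
      | nil =>
        simp at e; subst e
        have := (List.pairwise_cons.1 hM).1 b hb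
        omega
      | cons z T =>
        simp at e
        have := hT.1 z (by simp)
        omega
    · exact ih hT.2 h

lemma cont_TM {x : ℕ} {T M : List ℕ} (hT : T.Pairwise (· > ·)) (hM : M.Pairwise (· < ·)) :
    Cont (x :: (T ++ M)) ↔ ∃ y l' b, T ++ M = y :: l' ∧ b ∈ l' ∧ x < b ∧ b < y := by
  rw [cont_cons]
  simp [not_cont_TM T M hT hM]

lemma not_cont_M (x : ℕ) {M : List ℕ} (hM : M.Pairwise (· < ·)) : ¬ Cont (x :: M) := by
  rw [cont_cons]
  rintro (⟨y, l', b, rfl, hb, h1, h2⟩ | h)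
  · have := (List.pairwise_cons.1 hM).1 b hb
    omega
  · exact not_cont_TM [] M (by simp) hM h

lemma pp_min {x : ℕ} {S M : List ℕ} (hM : M.Pairwise (· < ·)) (hx : ∀ m ∈ M, x < m)
    (hS : ∀ s ∈ S, ∃ m ∈ M, m < s) : pp x (S ++ M) = (S, x :: M) := by
  induction S with
  | nil => exact pp_not (not_cont_M x hM)
  | cons y S ih =>
    obtain ⟨m, hm, hmy⟩ := hS y (by simp)
    rw [List.cons_append, pp_cont, ih (fun s hs => hS s (by simp [hs]))]
    rw [cont_cons]
    exact Or.inl ⟨y, S ++ M, m, rfl, by simp [hm], hx m hm, hmy⟩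

lemma pp_gen (x : ℕ) {M : List ℕ} (S : List ℕ) (hM : M.Pairwise (· < ·)) :
    ∃ P Q, S = P ++ Q ∧ pp x (S ++ M) = (P, (x :: Q) ++ M) := by
  induction S with
  | nil => exact ⟨[], [], rfl, pp_not (not_cont_M x hM)⟩
  | cons y S ih =>
    by_cases h : Cont (x :: y :: (S ++ M))
    · obtain ⟨P, Q, rfl, e⟩ := ih
      refine ⟨y :: P, Q, rfl, ?_⟩
      rw [List.cons_append, pp_cont h, e]
    · exact ⟨[], y :: S, rfl, by rw [List.cons_append, pp_not h]; rfl⟩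

lemma pp_good {x : ℕ} {S M : List ℕ} (hS : S.Pairwise (· > ·)) (hM : M.Pairwise (· < ·))
    (hx : x ∉ S) (hb : ∀ y ∈ S, x < y → ∃ m ∈ M, x < m ∧ m < y) :
    pp x (S ++ M) = (S.filter (fun y => x < y), (x :: S.filter (fun y => y < x)) ++ M) := by
  induction S with
  | nil => exact pp_not (not_cont_M x hM)
  | cons y S ih =>
    have hS' := List.pairwise_cons.1 hS
    simp only [List.mem_cons, not_or] at hx
    by_cases hxy : x < y
    · obtain ⟨m, hm, h1, h2⟩ := hb y (by simp) hxy
      rw [List.cons_append, pp_cont, ih hS'.2 hx.2 (fun y hy => hb y (by simp [hy]))]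
      · rw [List.filter_cons_of_pos (by simpa using hxy), List.filter_cons_of_neg (by simp; omega)]
      · rw [cont_cons]
        exact Or.inl ⟨y, S ++ M, m, rfl, by simp [hm], h1, h2⟩
    · have hyx : y < x := by omega
      have h1 : (y :: S).filter (fun z => decide (x < z)) = [] := by
        rw [List.filter_eq_nil_iff]
        intro z hz
        rcases List.mem_cons.1 hz with rfl | hz
        · simp; omega
        · have := hS'.1 z hz; simp; omega
      have h2 : (y :: S).filter (fun z => decide (z < x)) = y :: S := by
        rw [List.filter_eq_self]
        intro z hz
        rcases List.mem_cons.1 hz with rfl | hz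
        · simp; omega
        · have := hS'.1 z hz; simp; omega
      rw [h1, h2]
      apply pp_not
      rw [cont_TM hS hM]
      rintro ⟨z, l', b, e, hb, h3, h4⟩
      simp at e
      omega

lemma pp_bad {x : ℕ} {S M P Q : List ℕ} (hS : S.Pairwise (· > ·)) (hM : M.Pairwise (· < ·))
    (hx : x + 1 ∈ S) (e : pp x (S ++ M) = (P, (x :: Q) ++ M)) : x + 1 ∈ Q := by
  induction S generalizing P with
  | nil => simp at hx
  | cons y S ih =>
    have hS' := List.pairwise_cons.1 hS
    have main : ¬ Cont (x :: y :: (S ++ M)) → x + 1 ∈ Q := by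
      intro h
      rw [List.cons_append, pp_not h] at e
      simp only [Prod.mk.injEq, List.cons_append, List.cons.injEq, true_and] at e
      rw [← List.cons_append] at e
      rw [← List.append_cancel_right e.2]
      exact hx
    by_cases h : Cont (x :: y :: (S ++ M))
    · rcases List.mem_cons.1 hx with rfl | hx'
      · apply main
        rw [← List.cons_append, cont_TM hS hM]
        rintro ⟨z, l', b, e, hb, h3, h4⟩
        simp at e
        omega
      · rw [List.cons_append, pp_cont h] at e
        simp only [Prod.mk.injEq] at e
        exact ih hS'.2 hx' (P := (pp x (S ++ M)).1) (Prod.ext rfl e.2)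
    · exact main h

structure Str (τ O S M : List ℕ) : Prop where
  run : rn τ = (O, S ++ M)
  inc : M.Pairwise (· < ·)
  dom : ∀ y ∈ O ++ S, ∃ m ∈ M, m < y

lemma Str.perm {τ O S M : List ℕ} (h : Str τ O S M) : (O ++ S ++ M).Perm τ := by
  have := rn_perm τ
  rw [h.run] at this
  simpa using this

lemma Str.sort_iff {τ O S M : List ℕ} (h : Str τ O S M) (hn : τ.Nodup) :
    ¬ C231 (sc [1,3,2] {0} τ) ↔ (O ++ S).Pairwise (· > ·) := by
  rw [sc_eq, h.run, c231_iff]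
  simp only [← List.append_assoc]
  have hnd : (O ++ S ++ M).Nodup := h.perm.nodup_iff.2 hn
  constructor
  · intro hc
    rw [List.pairwise_iff_forall_sublist]
    intro a b hab
    by_contra hlt
    have hne : a ≠ b := by
      have := (List.nodup_append.1 hnd).1.sublist hab
      simpa using this
    obtain ⟨m, hm, hma⟩ := h.dom a (hab.subset (by simp))
    refine hc ⟨a, b, m, ?_, hma, by simp at hlt; omega⟩
    exact List.Sublist.append hab (List.singleton_sublist.2 hm)
  · rintro hp ⟨a, b, c, hs, h1, h2⟩
    rw [List.sublist_append_iff] at hs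
    obtain ⟨l1, l2, e, hl1, hl2⟩ := hs
    have p1 := hp.sublist hl1
    have p2 := h.inc.sublist hl2
    match l1, e with
    | [], e => simp at e; subst e; simp at p2; omega
    | [_], e => simp at e; obtain ⟨rfl, rfl⟩ := e; simp at p2; omega
    | _ :: _ :: _, e => simp at e; obtain ⟨rfl, rfl, _⟩ := e; simp at p1; omega

lemma Str.map {τ O S M : List ℕ} (h : Str τ O S M) (f : ℕ → ℕ) (hf : StrictMono f) :
    Str (τ.map f) (O.map f) (S.map f) (M.map f) := by
  refine ⟨?_, ?_, ?_⟩
  · rw [rn_map f hf, h.run]; simp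
  · exact List.pairwise_map.2 (h.inc.imp fun hab => hf hab)
  · intro y hy
    rw [← List.map_append, List.mem_map] at hy
    obtain ⟨z, hz, rfl⟩ := hy
    obtain ⟨m, hm, hmz⟩ := h.dom z hz
    exact ⟨f m, List.mem_map_of_mem hm, hf hmz⟩

lemma Str.step_min {τ O S M : List ℕ} (h : Str τ O S M) {x : ℕ} (hx : ∀ m ∈ M, x < m) :
    Str (τ ++ [x]) (O ++ S) [] (x :: M) := by
  refine ⟨?_, ?_, ?_⟩
  · rw [rn_append, h.run, stp]
    simp only
    rw [pp_min h.inc hx (fun s hs => h.dom s (by simp [hs]))]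
    simp
  · exact List.pairwise_cons.2 ⟨hx, h.inc⟩
  · intro y hy
    obtain ⟨m, hm, hmy⟩ := h.dom y (by simpa using hy)
    exact ⟨m, by simp [hm], hmy⟩

lemma Str.step_non {τ O S M P Q : List ℕ} (h : Str τ O S M) {x : ℕ} (hx : ∃ m ∈ M, m < x)
    (e : pp x (S ++ M) = (P, (x :: Q) ++ M)) :
    Str (τ ++ [x]) (O ++ P) (x :: Q) M := by
  have hp := pp_perm x (S ++ M)
  rw [e] at hp
  refine ⟨?_, h.inc, ?_⟩
  · rw [rn_append, h.run, stp]
    simp only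
    rw [e]
  · intro y hy
    by_cases hyx : y = x
    · subst hyx; exact hx
    · have : y ∈ O ∨ y ∈ S := by
        have hy' : y ∈ O ∨ y ∈ P ∨ y ∈ Q := by simpa [hyx] using hy
        rcases hy' with h1 | h1
        · exact Or.inl h1
        · right
          have hp' : (P ++ Q).Perm S := by
            have : ((x :: (P ++ Q)) ++ M).Perm ((x :: S) ++ M) := by
              refine List.Perm.trans ?_ hp
              rw [← List.append_assoc]
              exact (List.perm_middle.symm).append_right M
            rw [List.perm_append_right_iff] at this
            exact this.cons_inv
          exact hp'.subset (by simpa using h1)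
      exact h.dom y (by simpa using this)

lemma str_step {τ O S M : List ℕ} (h : Str τ O S M) {x : ℕ} (hx : x ∉ τ) :
    ∃ O' S' M', Str (τ ++ [x]) O' S' M' ∧ (O ++ S).Sublist (O' ++ S') := by
  by_cases hm : ∀ m ∈ M, x < m
  · exact ⟨_, _, _, h.step_min hm, by simp⟩
  · push Not at hm
    obtain ⟨m, hm, hmx⟩ := hm
    have hne : m ≠ x := by
      rintro rfl
      exact hx (h.perm.subset (by simp [hm]))
    obtain ⟨P, Q, rfl, e⟩ := pp_gen x S h.inc
    refine ⟨_, _, _, h.step_non ⟨m, hm, by omega⟩ e, ?_⟩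
    rw [List.append_assoc]
    exact (((List.sublist_cons_self x Q).append_left P)).append_left O

lemma str_exists (τ : List ℕ) (h : τ.Nodup) : ∃ O S M, Str τ O S M := by
  induction τ using List.reverseRecOn with
  | nil => exact ⟨[], [], [], by simp [rn], by simp, by simp⟩
  | append_singleton τ x ih =>
    have h' := List.nodup_append.1 h
    obtain ⟨O, S, M, hs⟩ := ih h'.1
    obtain ⟨O', S', M', hs', -⟩ := str_step hs (x := x)
      (fun hx => h'.2.2 x hx x (by simp) rfl)
    exact ⟨_, _, _, hs'⟩

lemma sort_prefix {τ : List ℕ} {f : ℕ → ℕ} (hf : StrictMono f) {x : ℕ}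
    (hn : (τ.map f ++ [x]).Nodup) (h : ¬ C231 (sc [1,3,2] {0} (τ.map f ++ [x]))) :
    ¬ C231 (sc [1,3,2] {0} τ) := by
  have h' := List.nodup_append.1 hn
  have hτ : τ.Nodup := h'.1.of_map
  obtain ⟨O, S, M, hs⟩ := str_exists τ hτ
  obtain ⟨O', S', M', hs', hsub⟩ := str_step (hs.map f hf) (x := x)
      (fun hx => h'.2.2 x hx x (by simp) rfl)
  rw [hs'.sort_iff hn] at h
  rw [hs.sort_iff hτ]
  have := h.sublist hsub
  rw [← List.map_append, List.pairwise_map] at this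
  exact this.imp fun hab => hf.lt_iff_lt.1 hab

end S132

namespace S132

lemma isPerm_iff (n : ℕ) (τ : List ℕ) :
    IsPermList n τ ↔ τ.Nodup ∧ ∀ k, k ∈ τ ↔ 1 ≤ k ∧ k ≤ n := by
  have hr : (List.range' 1 n).Nodup := List.nodup_range'
  have hm : ∀ k, k ∈ List.range' 1 n ↔ 1 ≤ k ∧ k ≤ n := by
    intro k; simp [List.mem_range'_1]; omega
  unfold IsPermList
  constructor
  · intro h
    exact ⟨h.nodup_iff.2 hr, fun k => by rw [h.mem_iff, hm]⟩
  · rintro ⟨h1, h2⟩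
    exact (List.perm_ext_iff_of_nodup h1 hr).2 fun k => by rw [h2, hm]

def bp (v k : ℕ) : ℕ := if k < v then k else k + 1

lemma bp_mono (v : ℕ) : StrictMono (bp v) := by
  intro a b hab; unfold bp; split_ifs <;> omega

def ins (τ : List ℕ) (v : ℕ) : List ℕ := τ.map (bp v) ++ [v]

lemma ins_perm {n v : ℕ} {τ : List ℕ} (h : IsPermList n τ) (h1 : 1 ≤ v) (h2 : v ≤ n + 1) :
    IsPermList (n+1) (ins τ v) := by
  rw [isPerm_iff] at *
  obtain ⟨hn, hm⟩ := h
  constructor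
  · unfold ins
    rw [List.nodup_append]
    refine ⟨hn.map (bp_mono v).injective, by simp, ?_⟩
    intro a ha b hb
    simp at ha hb
    obtain ⟨k, -, rfl⟩ := ha
    subst hb
    unfold bp; split_ifs <;> omega
  · intro k
    simp only [ins, List.mem_append, List.mem_map, List.mem_singleton]
    constructor
    · rintro (⟨j, hj, rfl⟩ | rfl)
      · have := (hm j).1 hj
        unfold bp; split_ifs <;> omega
      · omega
    · intro hk
      by_cases e : k = v
      · exact Or.inr e
      · left
        by_cases hlt : k < v
        · exact ⟨k, (hm k).2 (by omega), by simp [bp, hlt]⟩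
        · refine ⟨k - 1, (hm _).2 (by omega), ?_⟩
          unfold bp; split_ifs <;> omega

lemma ins_exists {n : ℕ} {τ : List ℕ} (h : IsPermList (n+1) τ) :
    ∃ τ' v, 1 ≤ v ∧ v ≤ n + 1 ∧ IsPermList n τ' ∧ τ = ins τ' v := by
  rw [isPerm_iff] at h
  obtain ⟨hn, hm⟩ := h
  rcases List.eq_nil_or_concat τ with rfl | ⟨τ0, v, rfl⟩
  · have := (hm 1).2 (by omega); simp at this
  rw [List.concat_eq_append] at *
  have hv := (hm v).1 (by simp)
  rw [List.nodup_append] at hn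
  obtain ⟨hn0, -, hd⟩ := hn
  have hv0 : ∀ k ∈ τ0, k ≠ v := fun k hk => hd k hk v (by simp)
  let g : ℕ → ℕ := fun k => if k < v then k else k - 1
  have e : (τ0.map g).map (bp v) = τ0 := by
    rw [List.map_map]
    conv_rhs => rw [← List.map_id τ0]
    apply List.map_congr_left
    intro k hk
    have := hv0 k hk
    simp only [Function.comp, bp, g, id]
    split_ifs <;> omega
  refine ⟨τ0.map g, v, hv.1, hv.2, ?_, by rw [ins, e]⟩
  rw [isPerm_iff]
  constructor
  · rw [← e] at hn0; exact hn0.of_map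
  · intro k
    rw [List.mem_map]
    have hm' : ∀ k, k ≠ v → (k ∈ τ0 ↔ 1 ≤ k ∧ k ≤ n + 1) := by
      intro k hk; rw [← hm k]; simp [hk]
    constructor
    · rintro ⟨j, hj, rfl⟩
      have h1 := hv0 j hj
      have h2 := (hm' j h1).1 hj
      simp only [g]; split_ifs <;> omega
    · intro hk
      by_cases hlt : k < v
      · exact ⟨k, (hm' k (by omega)).2 (by omega), by simp [g, hlt]⟩
      · refine ⟨k + 1, (hm' _ (by omega)).2 (by omega), ?_⟩
        simp only [g]; split_ifs <;> omega

lemma ins_inj {τ τ' : List ℕ} {v v' : ℕ} (h : ins τ v = ins τ' v') : τ = τ' ∧ v = v' := by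
  unfold ins at h
  have h2 := List.append_inj' h (by simp)
  obtain ⟨h1, h3⟩ := h2
  simp at h3
  subst h3
  exact ⟨List.map_injective_iff.2 (bp_mono v).injective h1, rfl⟩

structure Inv (n : ℕ) (τ O S M : List ℕ) (w : List Bool) : Prop where
  str : Str τ O S M
  dec : (O ++ S).Pairwise (· > ·)
  wt : ∀ i : ℕ, w[i]? = some true → i + 1 ∈ M
  wf : ∀ i : ℕ, w[i]? = some false ↔ i + 1 ∈ S
  ho : ∀ o ∈ O, w.length < o
  hl : w.length + 1 ∈ O ∨ w.length = n

lemma tw (l : List Bool) : ∃ t, t ≤ l.length ∧ l.takeWhile (fun b => b) = List.replicate t true ∧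
    (∀ j < t, l[j]? = some true) ∧ (t < l.length → l[t]? = some false) := by
  induction l with
  | nil => exact ⟨0, by simp⟩
  | cons b l ih =>
    cases b with
    | false => exact ⟨0, by simp⟩
    | true =>
      obtain ⟨t, h1, h2, h3, h4⟩ := ih
      refine ⟨t + 1, by simpa using h1, by simp [h2, List.replicate_succ], ?_, ?_⟩
      · intro j hj
        cases j with
        | zero => simp
        | succ j => simpa using h3 j (by omega)
      · intro h; simpa using h4 (by simpa using h)

lemma Inv.len_le {n : ℕ} {τ O S M : List ℕ} {w : List Bool} (h : Inv n τ O S M w)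
    (hp : IsPermList n τ) : w.length ≤ n := by
  rw [isPerm_iff] at hp
  rcases h.hl with h1 | h1
  · have := (hp.2 _).1 (h.str.perm.subset (show w.length + 1 ∈ _ by simp [h1])); omega
  · omega

lemma Inv.one_mem {n : ℕ} {τ O S M : List ℕ} {w : List Bool} (h : Inv n τ O S M w)
    (hp : IsPermList n τ) (hn : 1 ≤ n) : 1 ∈ M := by
  rw [isPerm_iff] at hp
  have h1 : 1 ∈ O ++ S ++ M := h.str.perm.mem_iff.2 ((hp.2 1).2 (by omega))
  rw [List.mem_append] at h1
  rcases h1 with h1 | h1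
  · obtain ⟨m, hm, hlt⟩ := h.str.dom 1 h1
    have := (hp.2 m).1 (h.str.perm.subset (by simp [hm]))
    omega
  · exact h1

lemma inv_step_zero {n : ℕ} {τ O S M : List ℕ} {w : List Bool} (h : Inv n τ O S M w)
    (hp : IsPermList n τ) :
    ∃ O' S' M', Inv (n+1) (ins τ 1) O' S' M' (mv w 0) := by
  have hp' := (isPerm_iff n τ).1 hp
  have hpos : ∀ k, k ∈ O ++ S ++ M → 1 ≤ k := fun k hk => ((hp'.2 k).1 (h.str.perm.subset hk)).1
  have hs := (h.str.map (bp 1) (bp_mono 1)).step_min (x := 1) (by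
    intro m hm
    rw [List.mem_map] at hm
    obtain ⟨k, hk, rfl⟩ := hm
    have := hpos k (by simp [hk])
    unfold bp; split_ifs <;> omega)
  obtain ⟨t, h1, h2, h3, h4⟩ := tw w
  have ew : mv w 0 = true :: List.replicate t true := by simp [mv, h2]
  have bps : ∀ k, 1 ≤ k → bp 1 k = k + 1 := by
    intro k hk; unfold bp; split_ifs <;> omega
  refine ⟨_, _, _, hs, ?_, ?_, ?_, ?_, ?_⟩
  · rw [List.append_nil, ← List.map_append, List.pairwise_map]
    exact h.dec.imp fun hab => bp_mono 1 hab
  · intro i hi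
    rw [ew] at hi
    cases i with
    | zero => simp
    | succ i =>
      have hi' : i < t := by
        by_contra hge
        simp [hge] at hi
      have := h.wt i (h3 i hi')
      rw [← bps (i+1) (by omega)]
      exact List.mem_cons_of_mem _ (List.mem_map_of_mem this)
  · intro i
    rw [ew, ← List.replicate_succ, List.getElem?_replicate]
    split_ifs <;> simp
  · intro o ho
    rw [ew, List.length_cons, List.length_replicate]
    rw [← List.map_append, List.mem_map] at ho
    obtain ⟨k, hk, rfl⟩ := ho
    rw [bps k (hpos k (by simp at hk ⊢; tauto))]
    rcases List.mem_append.1 hk with hk | hk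
    · have := h.ho k hk; omega
    · have hk1 := hpos k (by simp [hk])
      have hw := (h.wf (k - 1)).2 (by rwa [show k - 1 + 1 = k by omega])
      by_contra hlt
      rw [h3 (k-1) (by omega)] at hw
      simp at hw
  · rw [ew, List.length_cons, List.length_replicate]
    rcases h1.lt_or_eq with hlt | heq
    · left
      have := (h.wf t).1 (h4 hlt)
      rw [← bps (t+1) (by omega), ← List.map_append]
      exact List.mem_map_of_mem (by simp [this])
    · rcases h.hl with hl | hl
      · left
        rw [← bps (t+1) (by omega), ← List.map_append]
        exact List.mem_map_of_mem (by simp [heq, hl])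
      · right; omega

lemma inv_step_pos {n i : ℕ} {τ O S M : List ℕ} {w : List Bool} (h : Inv n τ O S M w)
    (hp : IsPermList n τ) (hi0 : 0 < i) (hi : i ≤ w.length) (hw : w[i]? ≠ some false) :
    ∃ O' S' M', Inv (n+1) (ins τ (i+1)) O' S' M' (mv w i) := by
  have hp' := (isPerm_iff n τ).1 hp
  have hpos : ∀ k, k ∈ O ++ S ++ M → 1 ≤ k := fun k hk => ((hp'.2 k).1 (h.str.perm.subset hk)).1
  have hlen := h.len_le hp
  have h1M := h.one_mem hp (by omega)
  have bs : ∀ k, k ≤ i → bp (i+1) k = k := by intro k hk; unfold bp; split_ifs <;> omega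
  have bb : ∀ k, i < k → bp (i+1) k = k + 1 := by intro k hk; unfold bp; split_ifs <;> omega
  have hSm : ∀ k ∈ S, 1 ≤ k ∧ w[k-1]? = some false := by
    intro k hk
    have hk1 := hpos k (by simp [hk])
    exact ⟨hk1, (h.wf (k - 1)).2 (by rwa [show k - 1 + 1 = k by omega])⟩
  have hm := h.str.map (bp (i+1)) (bp_mono (i+1))
  have hdec : (O.map (bp (i+1)) ++ S.map (bp (i+1))).Pairwise (· > ·) := by
    rw [← List.map_append, List.pairwise_map]
    exact h.dec.imp fun hab => bp_mono _ hab
  rw [List.pairwise_append] at hdec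
  obtain ⟨dO, dS, dOS⟩ := hdec
  have hpp := pp_good (x := i+1) dS hm.inc (by
      intro hx
      obtain ⟨k, -, hk⟩ := List.mem_map.1 hx
      revert hk
      unfold bp; split_ifs <;> omega) (by
      intro y hy hlt
      obtain ⟨k, hk, rfl⟩ := List.mem_map.1 hy
      have hki : i < k := by
        by_contra hge
        rw [bs k (by omega)] at hlt; omega
      rw [bb k hki]
      obtain ⟨hk1, hkw⟩ := hSm k hk
      have hkl : k - 1 < w.length := by
        by_contra hge
        rw [List.getElem?_eq_none (by omega)] at hkw; simp at hkw
      have hil : i < w.length := by omega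
      have hit : w[i]? = some true := by
        rw [List.getElem?_eq_getElem hil] at hw ⊢
        cases hwi : w[i] <;> simp_all
      have hiM := h.wt i hit
      have hne : k ≠ i + 1 := by
        rintro rfl
        simp only [Nat.add_sub_cancel] at hkw
        exact hw hkw
      exact ⟨bp (i+1) (i+1), List.mem_map_of_mem hiM, by rw [bb _ (by omega)]; omega,
        by rw [bb _ (by omega)]; omega⟩)
  have hs := hm.step_non ⟨bp (i+1) 1, List.mem_map_of_mem h1M, by rw [bs 1 hi0]; omega⟩ hpp
  obtain ⟨t, h1, h2, h3, h4⟩ := tw (w.drop i)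
  rw [List.length_drop] at h1 h4
  simp only [List.getElem?_drop] at h3 h4
  have ew : mv w i = w.take i ++ false :: List.replicate t true := by
    simp [mv, h2]; omega
  have el : (mv w i).length = i + 1 + t := by
    rw [ew]; simp; omega
  have elt : ∀ j, j < i → (mv w i)[j]? = w[j]? := by
    intro j hj
    rw [ew, List.getElem?_append_left (by simp; omega), List.getElem?_take_of_lt hj]
  have eeq : (mv w i)[i]? = some false := by
    rw [ew, List.getElem?_append_right (by simp)]
    simp [hi]
  have egt : ∀ j, i < j → (mv w i)[j]? = if j - i - 1 < t then some true else none := by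
    intro j hj
    rw [ew, List.getElem?_append_right (by simp; omega)]
    rw [List.length_take, min_eq_left hi, show j - i = (j - i - 1) + 1 by omega,
      List.getElem?_cons_succ, List.getElem?_replicate]
    simp
  refine ⟨_, _, _, hs, ?_, ?_, ?_, ?_, ?_⟩
  · rw [List.pairwise_append]
    refine ⟨?_, ?_, ?_⟩
    · rw [List.pairwise_append]
      exact ⟨dO, dS.sublist List.filter_sublist, fun a ha b hb => dOS a ha b (List.mem_of_mem_filter hb)⟩
    · rw [List.pairwise_cons]
      refine ⟨fun a ha => ?_, dS.sublist List.filter_sublist⟩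
      have := (List.mem_filter.1 ha).2
      simpa using this
    · intro a ha b hb
      have ha' : i + 1 < a := by
        rcases List.mem_append.1 ha with ha | ha
        · obtain ⟨k, hk, rfl⟩ := List.mem_map.1 ha
          have := h.ho k hk
          rw [bb k (by omega)]; omega
        · simpa using (List.mem_filter.1 ha).2
      have hb' : b ≤ i + 1 := by
        rcases List.mem_cons.1 hb with rfl | hb
        · exact le_rfl
        · have := (List.mem_filter.1 hb).2
          simp only [decide_eq_true_eq] at this
          omega
      show b < a
      omega
  · intro j hj
    rcases lt_trichotomy j i with hji | rfl | hji
    · rw [elt j hji] at hj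
      rw [← bs (j+1) (by omega)]
      exact List.mem_map_of_mem (h.wt j hj)
    · rw [eeq] at hj; simp at hj
    · rw [egt j hji] at hj
      split_ifs at hj with hjt
      have := h.wt _ (h3 _ hjt)
      rw [show i + (j - i - 1) + 1 = j by omega] at this
      rw [← bb j hji]
      exact List.mem_map_of_mem this
  · intro j
    rcases lt_trichotomy j i with hji | rfl | hji
    · rw [elt j hji, h.wf j]
      constructor
      · intro hj
        refine List.mem_cons_of_mem _ (List.mem_filter.2 ⟨?_, by simp; omega⟩)
        rw [← bs (j+1) (by omega)]
        exact List.mem_map_of_mem hj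
      · intro hj
        rcases List.mem_cons.1 hj with hj | hj
        · omega
        · obtain ⟨k, hk, hkj⟩ := List.mem_map.1 (List.mem_of_mem_filter hj)
          rw [← bs (j+1) (by omega)] at hkj
          rw [← (bp_mono _).injective hkj]
          exact hk
    · simp [eeq]
    · rw [egt j hji]
      constructor
      · intro hj; split_ifs at hj <;> simp at hj
      · intro hj
        rcases List.mem_cons.1 hj with hj | hj
        · omega
        · have := (List.mem_filter.1 hj).2
          simp only [decide_eq_true_eq] at this
          omega
  · intro o ho
    rw [el]
    rcases List.mem_append.1 ho with ho | ho
    · obtain ⟨k, hk, rfl⟩ := List.mem_map.1 ho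
      have := h.ho k hk
      rw [bb k (by omega)]; omega
    · obtain ⟨ho1, ho2⟩ := List.mem_filter.1 ho
      simp only [decide_eq_true_eq] at ho2
      obtain ⟨k, hk, rfl⟩ := List.mem_map.1 ho1
      have hki : i < k := by
        by_contra hge
        rw [bs k (by omega)] at ho2; omega
      rw [bb k hki]
      obtain ⟨hk1, hkw⟩ := hSm k hk
      by_contra hlt
      have := h3 (k - 1 - i) (by omega)
      rw [show i + (k - 1 - i) = k - 1 by omega, hkw] at this
      simp at this
  · rw [el]
    rcases h1.lt_or_eq with hlt | heq
    · left
      have := (h.wf _).1 (h4 hlt)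
      refine List.mem_append_right _ (List.mem_filter.2 ⟨?_, by rw [decide_eq_true_eq]; omega⟩)
      rw [show i + 1 + t + 1 = (i + t + 1) + 1 by omega, ← bb (i + t + 1) (by omega)]
      exact List.mem_map_of_mem this
    · rcases h.hl with hl | hl
      · left
        refine List.mem_append_left _ ?_
        rw [show i + 1 + t + 1 = (w.length + 1) + 1 by omega, ← bb (w.length + 1) (by omega)]
        exact List.mem_map_of_mem hl
      · right; omega

lemma inv_bad {n i : ℕ} {τ O S M : List ℕ} {w : List Bool} (h : Inv n τ O S M w)
    (hp : IsPermList n τ) (hin : i ≤ n)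
    (hs : ¬ C231 (sc [1,3,2] {0} (ins τ (i+1)))) : i ≤ w.length ∧ w[i]? ≠ some false := by
  have hp' := (isPerm_iff n τ).1 hp
  have hpos : ∀ k, k ∈ O ++ S ++ M → 1 ≤ k := fun k hk => ((hp'.2 k).1 (h.str.perm.subset hk)).1
  have hnd := ((isPerm_iff _ _).1 (ins_perm hp (v := i+1) (by omega) (by omega))).1
  have bs : ∀ k, k ≤ i → bp (i+1) k = k := by intro k hk; unfold bp; split_ifs <;> omega
  have bb : ∀ k, i < k → bp (i+1) k = k + 1 := by intro k hk; unfold bp; split_ifs <;> omega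
  have hm := h.str.map (bp (i+1)) (bp_mono (i+1))
  obtain ⟨P, Q, hPQ, hpp⟩ := pp_gen (i+1) (S.map (bp (i+1))) hm.inc
  have main : 0 < i → ((O.map (bp (i+1)) ++ P) ++ (i+1) :: Q).Pairwise (· > ·) := by
    intro hi0
    have h1M := h.one_mem hp (by omega)
    have hst := hm.step_non ⟨bp (i+1) 1, List.mem_map_of_mem h1M, by rw [bs 1 hi0]; omega⟩ hpp
    exact (hst.sort_iff hnd).1 hs
  constructor
  · by_contra hlt
    have hO : w.length + 1 ∈ O := by
      rcases h.hl with h1 | h1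
      · exact h1
      · omega
    have := main (by omega)
    rw [List.pairwise_append] at this
    have := this.2.2 (bp (i+1) (w.length + 1)) (List.mem_append_left _ (List.mem_map_of_mem hO)) (i+1) (by simp)
    rw [bs _ (by omega)] at this
    omega
  · intro hw
    have hS := (h.wf i).1 hw
    have hi0 : 0 < i := by
      obtain ⟨m, hmM, hlt⟩ := h.str.dom (i+1) (by simp [hS])
      have := hpos m (by simp [hmM])
      omega
    have hdS : (S.map (bp (i+1))).Pairwise (· > ·) := by
      rw [List.pairwise_map]
      exact (List.pairwise_append.1 h.dec).2.1.imp fun hab => bp_mono _ hab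
    have hQ := pp_bad hdS hm.inc (by
      rw [← bb (i+1) (by omega)]; exact List.mem_map_of_mem hS) hpp
    have := (List.pairwise_cons.1 (List.pairwise_append.1 (main hi0)).2.1).1 _ hQ
    omega

def mvs (w : List Bool) : List ℕ :=
  (List.range (w.length + 1)).filter (fun i => w[i]? ≠ some false)

def gen : ℕ → List (List ℕ × List Bool)
  | 0 => [([], [])]
  | n+1 => (gen n).flatMap fun p => (mvs p.2).map fun i => (ins p.1 (i+1), mv p.2 i)

lemma mem_mvs {w : List Bool} {i : ℕ} : i ∈ mvs w ↔ i ≤ w.length ∧ w[i]? ≠ some false := by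
  simp [mvs, Nat.lt_succ_iff]

lemma gen_inv (n : ℕ) : ∀ p ∈ gen n, IsPermList n p.1 ∧ ∃ O S M, Inv n p.1 O S M p.2 := by
  induction n with
  | zero =>
    intro p hp
    simp [gen] at hp
    subst hp
    refine ⟨by simp [IsPermList], [], [], [], ⟨by simp [rn], by simp, by simp⟩, ?_, ?_, ?_, ?_, ?_⟩ <;>
      simp
  | succ n ih =>
    intro p hp
    simp only [gen, List.mem_flatMap, List.mem_map] at hp
    obtain ⟨⟨τ, w⟩, hq, i, hi, rfl⟩ := hp
    obtain ⟨h1, O, S, M, h2⟩ := ih _ hq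
    rw [mem_mvs] at hi
    have hl := h2.len_le h1
    simp only at *
    refine ⟨ins_perm h1 (by omega) (by omega), ?_⟩
    rcases Nat.eq_zero_or_pos i with rfl | hi0
    · exact inv_step_zero h2 h1
    · exact inv_step_pos h2 h1 hi0 hi.1 hi.2

lemma gen_complete (n : ℕ) : ∀ τ, IsPermList n τ → ¬ C231 (sc [1,3,2] {0} τ) →
    ∃ w, (τ, w) ∈ gen n := by
  induction n with
  | zero =>
    intro τ h _
    simp [IsPermList] at h
    subst h
    exact ⟨[], by simp [gen]⟩
  | succ n ih =>
    intro τ h hs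
    have hnd := ((isPerm_iff _ _).1 h).1
    obtain ⟨τ', v, hv1, hv2, hp, rfl⟩ := ins_exists h
    obtain ⟨w, hw⟩ := ih τ' hp (sort_prefix (bp_mono v) hnd hs)
    obtain ⟨-, O, S, M, hI⟩ := gen_inv n _ hw
    obtain ⟨i, rfl⟩ : ∃ i, v = i + 1 := ⟨v - 1, by omega⟩
    have := inv_bad hI hp (by omega) hs
    refine ⟨mv w i, ?_⟩
    simp only [gen, List.mem_flatMap, List.mem_map]
    exact ⟨(τ', w), hw, i, mem_mvs.2 this, rfl⟩

lemma gen_nodup (n : ℕ) : ((gen n).map Prod.fst).Nodup := by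
  induction n with
  | zero => simp [gen]
  | succ n ih =>
    have e : (gen (n+1)).map Prod.fst =
        (gen n).flatMap fun p => (mvs p.2).map fun i => ins p.1 (i+1) := by
      simp [gen, List.map_flatMap, Function.comp_def]
    rw [e, List.nodup_flatMap]
    constructor
    · intro p _
      refine List.Nodup.map ?_ ((List.nodup_range).filter _)
      intro a b hab
      have := (ins_inj hab).2
      omega
    · rw [List.Nodup, List.pairwise_map] at ih
      refine ih.imp ?_
      intro p q hpq x hx hy
      simp only [List.mem_map] at hx hy
      obtain ⟨i, -, rfl⟩ := hx
      obtain ⟨j, -, hj⟩ := hy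
      exact hpq (ins_inj hj).1.symm

lemma sum_filter_range (k : ℕ) (p : ℕ → Prop) [DecidablePred p] (f : ℕ → ℕ) :
    (((List.range k).filter (fun i => p i)).map f).sum =
      ∑ i ∈ Finset.range k, if p i then f i else 0 := by
  induction k with
  | zero => simp
  | succ k ih =>
    rw [List.range_succ, List.filter_append, List.map_append, List.sum_append, ih,
      Finset.sum_range_succ]
    congr 1
    by_cases h : p k <;> simp [h]

lemma gen_sum (n : ℕ) : ∀ N, ((gen n).map fun p => ff N p.2).sum = ff (n + N) [] := by
  induction n with
  | zero => intro N; simp [gen]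
  | succ n ih =>
    intro N
    rw [show n + 1 + N = n + (N + 1) by omega, ← ih (N+1)]
    simp only [gen, List.map_flatMap, List.map_map, Function.comp_def]
    rw [List.flatMap, List.sum_flatten, List.map_map]
    congr 1
    apply List.map_congr_left
    intro p _
    simp only [Function.comp_def, ff, mvs]
    rw [← sum_filter_range]

lemma gen_length (n : ℕ) : (gen n).length = ff n [] := by
  have := gen_sum n 0
  simpa [ff] using this

lemma sortSet_eq (n : ℕ) :
    SortSet [1, 3, 2] {0} n = (((gen n).map Prod.fst).toFinset : Set (List ℕ)) := by
  ext τ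
  simp only [SortSet, Set.mem_ofPred_eq, Finset.mem_coe, List.mem_toFinset, List.mem_map]
  constructor
  · rintro ⟨h1, h2⟩
    obtain ⟨w, hw⟩ := gen_complete n τ h1 h2
    exact ⟨_, hw, rfl⟩
  · rintro ⟨p, hp, rfl⟩
    obtain ⟨h1, O, S, M, h2⟩ := gen_inv n p hp
    exact ⟨h1, (h2.str.sort_iff ((isPerm_iff _ _).1 h1).1).2 h2.dec⟩

end S132

/-- |Sort_n(sc_{\un{13}2})| = ∑_{i=0}^{n-1} binom(n-1, i) · C_i for n ≥ 1. -/
theorem card_sortingClass_un132 (n : ℕ) (hn : 1 ≤ n) :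
    (SortSet [1, 3, 2] {0} n).ncard =
      ∑ i ∈ Finset.range n, (n - 1).choose i * catalan i := by
  rw [S132.sortSet_eq, Set.ncard_coe_finset, List.toFinset_card_of_nodup (S132.gen_nodup n),
    List.length_map, S132.gen_length]
  obtain ⟨m, rfl⟩ : ∃ m, n = m + 1 := ⟨n - 1, by omega⟩
  exact S132.ff_nil m
end

section
/- For every n, the sorting class of the 1\underline{32}-avoiding stack-sorting map is enumerated by the Catalan numbers: |Sort_n(sc_{1\underline{32}})| = C_n. -/
namespace SC
def C (τ : List ℕ) : Prop := ∃ y b a u v, τ = u ++ b :: a :: v ∧ y ∈ u ∧ y < a ∧ a < b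

lemma contains_iff (τ : List ℕ) : ContainsV [1,3,2] {1} τ ↔ C τ := by
  constructor
  · rintro ⟨f, hf, hp, hA⟩
    have h01 : f 0 < f 1 := hf (by decide)
    have h2 : (f 2 : ℕ) = f 1 + 1 := hA 1 rfl (by decide)
    have p1 : τ.get (f 0) < τ.get (f 2) := (hp 0 2).1 (by decide)
    have p2 : τ.get (f 2) < τ.get (f 1) := (hp 2 1).1 (by decide)
    have hl : (f 1 : ℕ) + 1 < τ.length := h2 ▸ (f 2).2
    refine ⟨τ.get (f 0), τ.get (f 1), τ.get (f 2), τ.take (f 1), τ.drop (f 1 + 2), ?_, ?_, p1, p2⟩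
    · have e1 : τ.get (f 2) = τ[(f 1 : ℕ) + 1] := by simp [h2]
      rw [e1]
      conv_lhs => rw [← List.take_append_drop (f 1) τ]
      rw [List.drop_eq_getElem_cons (f 1).2, List.drop_eq_getElem_cons hl]
      rfl
    · rw [List.mem_take_iff_getElem]
      exact ⟨f 0, by simpa using h01, rfl⟩
  · rintro ⟨y, b, a, u, v, rfl, hy, h1, h2⟩
    obtain ⟨i, hi, rfl⟩ := List.mem_iff_getElem.1 hy
    refine ⟨![⟨i, by simp; omega⟩, ⟨u.length, by simp⟩, ⟨u.length + 1, by simp⟩], ?_, ?_, ?_⟩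
    · intro p q hpq
      fin_cases p <;> fin_cases q <;> simp_all <;> omega
    · intro p q
      fin_cases p <;> fin_cases q <;> simp [List.getElem_append_left hi] <;> omega
    · rintro _ rfl h
      rfl

lemma contains231_iff (τ : List ℕ) : ContainsV [2,3,1] ∅ τ ↔
    ∃ a b c, [a,b,c].Sublist τ ∧ c < a ∧ a < b := by
  constructor
  · rintro ⟨f, hf, hp, hA⟩
    refine ⟨τ.get (f 0), τ.get (f 1), τ.get (f 2), ?_, (hp 2 0).1 (by decide), (hp 0 1).1 (by decide)⟩
    rw [List.sublist_iff_exists_fin_orderEmbedding_get_eq]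
    refine ⟨OrderEmbedding.ofStrictMono f hf, ?_⟩
    intro i
    fin_cases i <;> rfl
  · rintro ⟨a, b, c, hs, h1, h2⟩
    rw [List.sublist_iff_exists_fin_orderEmbedding_get_eq] at hs
    obtain ⟨f, hf⟩ := hs
    refine ⟨f, f.strictMono, ?_, by simp⟩
    intro p q
    have e := hf p
    have e' := hf q
    change _ ↔ τ.get (f p) < τ.get (f q)
    rw [← e, ← e']
    fin_cases p <;> fin_cases q <;> simp <;> omega

noncomputable abbrev S (st l : List ℕ) := scAux [1,3,2] {1} st l

open Classical in
lemma S_cons (y x : ℕ) (st l) : S (y :: st) (x :: l) =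
    if C (x :: y :: st) then y :: S st (x :: l) else S (x :: y :: st) l := by
  simp only [S, scAux, contains_iff]
lemma S_push (y x : ℕ) (st l) (h : ¬ C (x :: y :: st)) : S (y :: st) (x :: l) = S (x :: y :: st) l := by
  rw [S_cons, if_neg h]
lemma S_pop (y x : ℕ) (st l) (h : C (x :: y :: st)) : S (y :: st) (x :: l) = y :: S st (x :: l) := by
  rw [S_cons, if_pos h]
lemma S_nil (st) : S st [] = st := by simp only [S, scAux]
lemma S_nil' (x l) : S [] (x :: l) = S [x] l := by simp only [S, scAux]

lemma S_ind (P : List ℕ → List ℕ → Prop) (h1 : ∀ st, P st []) (h2 : ∀ x l, P [x] l → P [] (x :: l))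
    (h3 : ∀ y st x l, C (x :: y :: st) → P st (x :: l) → P (y :: st) (x :: l))
    (h4 : ∀ y st x l, ¬ C (x :: y :: st) → P (x :: y :: st) l → P (y :: st) (x :: l)) (st l) : P st l := by
  induction hn : st.length + 2 * l.length using Nat.strong_induction_on generalizing st l with
  | _ n ih =>
    subst hn
    match st, l with
    | st, [] => exact h1 st
    | [], x :: l => exact h2 x l (ih _ (by simp; omega) _ _ rfl)
    | y :: st, x :: l =>
      by_cases h : C (x :: y :: st)
      · exact h3 _ _ _ _ h (ih _ (by simp) _ _ rfl)
      · exact h4 _ _ _ _ h (ih _ (by simp; omega) _ _ rfl)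

lemma S_perm (st l) : (S st l).Perm (st ++ l) := by
  refine S_ind (fun st l => (S st l).Perm (st ++ l)) ?_ ?_ ?_ ?_ st l
  · intro st; simp [S_nil]
  · intro x l h; rw [S_nil']; simpa using h
  · intro y st x l hc h; rw [S_pop _ _ _ _ hc]; simpa using h
  · intro y st x l hc h; rw [S_push _ _ _ _ hc]
    refine h.trans ?_
    simpa using (List.perm_middle (a := x) (l₁ := y :: st) (l₂ := l)).symm

lemma C_snoc_of (s : List ℕ) (m) (h : C s) : C (s ++ [m]) := by
  obtain ⟨y, b, a, u, v, rfl, h⟩ := h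
  exact ⟨y, b, a, u, v ++ [m], by simp, h⟩

lemma C_snoc_cases (s : List ℕ) (m) (h : C (s ++ [m])) : C s ∨ ∃ y ∈ s, y < m ∧ ∃ b u, s = u ++ [b] ∧ m < b := by
  obtain ⟨y, b, a, u, v, he, h1, h2, h3⟩ := h
  rcases List.eq_nil_or_concat v with rfl | ⟨v, z, rfl⟩
  · have : u ++ [b] ++ [a] = s ++ [m] := by simp [he]
    have e1 := List.append_inj_left' this rfl
    have e2 := List.append_inj_right' this rfl
    simp only [List.cons.injEq, and_true] at e2
    subst e2
    exact Or.inr ⟨y, by rw [← e1]; simp [h1], h2, b, u, e1.symm, h3⟩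
  · left
    have : (u ++ b :: a :: v) ++ [z] = s ++ [m] := by simp [he]
    have := List.append_inj_left' this rfl
    exact ⟨y, b, a, u, v, this.symm, h1, h2, h3⟩

lemma C_low (s : List ℕ) (m) (h : ∀ y ∈ s, m < y) : C (s ++ [m]) ↔ C s := by
  refine ⟨fun hc => ?_, C_snoc_of s m⟩
  rcases C_snoc_cases s m hc with h1 | ⟨y, hy, h2, -⟩
  · exact h1
  · have := h y hy; omega

lemma C_high (s : List ℕ) (x m) (h : x < m) : C (s ++ [x, m]) ↔ C (s ++ [x]) := by
  have e : s ++ [x, m] = (s ++ [x]) ++ [m] := by simp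
  rw [e]
  refine ⟨fun hc => ?_, C_snoc_of _ m⟩
  rcases C_snoc_cases _ m hc with h1 | ⟨y, hy, h2, b, u, h3, h4⟩
  · exact h1
  · have := List.append_inj_right' h3 rfl
    simp at this; omega

lemma not_C_two (x y) : ¬ C [x, y] := by
  rintro ⟨y, b, a, u, v, he, h1, h2, h3⟩
  have := congrArg List.length he
  have := List.length_pos_of_mem h1
  simp at *; omega

lemma S_flush (x m : ℕ) (hx : x < m) (t st : List ℕ) (h : ∀ y ∈ st, m < y) :
    S (st ++ [m]) (x :: t) = st ++ S [m] (x :: t) := by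
  induction st with
  | nil => rfl
  | cons y st ih =>
    rw [List.cons_append, S_pop, ih (fun z hz => h z (by simp [hz]))]; rfl
    obtain ⟨u, b, hu⟩ : ∃ u b, y :: st = u ++ [b] := by
      rcases List.eq_nil_or_concat (y :: st) with h | ⟨u, b, h⟩
      · simp at h
      · exact ⟨u, b, by simpa using h⟩
    refine ⟨x, b, m, x :: u, [], ?_, by simp, hx, h b (by simp [hu])⟩
    rw [← List.cons_append, hu]; simp

lemma S_block (m : ℕ) (t : List ℕ) (ht : ∀ x ∈ t.head?, x < m) (st R : List ℕ) :
    (∀ y ∈ st, m < y) → (∀ y ∈ R, m < y) → S (st ++ [m]) (R ++ t) = S st R ++ S [m] t := by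
  refine S_ind (fun st R => (∀ y ∈ st, m < y) → (∀ y ∈ R, m < y) → S (st ++ [m]) (R ++ t) = S st R ++ S [m] t) ?_ ?_ ?_ ?_ st R
  · intro st h _
    cases t with
    | nil => simp [S_nil]
    | cons x t => rw [S_nil]; exact S_flush x m (ht x rfl) t st h
  · intro x l ih h1 h2
    rw [S_nil', ← ih (by intro y hy; exact h2 y (by simp at hy; simp [hy])) (fun y hy => h2 y (by simp [hy]))]
    exact S_push _ _ _ _ (not_C_two _ _)
  · intro y st x l hc ih h1 h2
    rw [S_pop _ _ _ _ hc, List.cons_append, List.cons_append, List.cons_append, ← ih (fun y hy => h1 y (by simp [hy])) h2]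
    exact S_pop _ _ _ _ (C_snoc_of _ m hc)
  · intro y st x l hc ih h1 h2
    have h3 : ∀ z ∈ x :: y :: st, m < z := by
      intro z hz
      rcases List.mem_cons.1 hz with rfl | hz
      · exact h2 _ (by simp)
      · exact h1 _ hz
    rw [S_push _ _ _ _ hc, ← ih h3 (fun y hy => h2 y (by simp [hy]))]
    exact S_push _ _ _ _ (fun h => hc ((C_low (x :: y :: st) m h3).1 h))

lemma S_high (m x : ℕ) (hx : x < m) (s t : List ℕ) :
    S (s ++ [x, m]) t = S (s ++ [x]) t ++ [m] := by
  refine S_ind (fun st t => ∀ s, st = s ++ [x] → S (s ++ [x, m]) t = S (s ++ [x]) t ++ [m]) ?_ ?_ ?_ ?_ _ t s rfl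
  · intro st s _; simp [S_nil]
  · intro z l ih s h; simp at h
  · rintro y st z l hc ih (_ | ⟨w, s⟩) h
    · simp at h; obtain ⟨rfl, rfl⟩ := h
      exact absurd hc (not_C_two _ _)
    · simp at h; obtain ⟨rfl, rfl⟩ := h
      have := ih s rfl
      simp only [List.cons_append] at hc ⊢
      rw [S_pop _ _ _ _ hc, List.cons_append, ← this]
      exact S_pop _ _ _ _ ((C_high (z :: y :: s) x m hx).2 hc)
  · intro y st z l hc ih s h
    have h2 := ih (z :: s) (by simp [h])
    rw [h] at hc
    have hc' : ¬ C (z :: (s ++ [x, m])) := fun h => hc ((C_high (z :: s) x m hx).1 h)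
    simp only [List.cons_append] at h2
    cases s with
    | nil => simp only [List.nil_append] at *; rw [S_push _ _ _ _ hc, S_push _ _ _ _ hc', h2]
    | cons w s => simp only [List.cons_append] at *; rw [S_push _ _ _ _ hc, S_push _ _ _ _ hc', h2]

noncomputable abbrev g (l : List ℕ) := S [] l

lemma g_nil : g [] = [] := S_nil []

lemma g_rec (m : ℕ) (R t : List ℕ) (hR : ∀ y ∈ R, m < y) (ht : ∀ x ∈ t.head?, x < m) :
    g (m :: (R ++ t)) = g R ++ (g t ++ [m]) := by
  rw [g, S_nil']
  rw [show [m] = [] ++ [m] from rfl, S_block m t ht [] R (by simp) hR]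
  congr 1
  cases t with
  | nil => simp [S_nil, g]
  | cons x t =>
    rw [S_push _ _ _ _ (not_C_two _ _), g, S_nil']
    exact S_high m x (ht x rfl) [] t

end SC
namespace SC

def Av (l : List ℕ) : Prop := ∀ a b c, [a, b, c].Sublist l → c < a → ¬ a < b

inductive Good : List ℕ → Prop
  | nil : Good []
  | cons (m : ℕ) (R t : List ℕ) (h1 : ∀ y ∈ R, m < y) (h2 : ∀ x ∈ t.head?, x < m)
      (h3 : R.Pairwise (· < ·)) (h4 : ∀ a ∈ R, ∀ b ∈ t, b < a) (h5 : Good t) : Good (m :: (R ++ t))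

lemma mem_g {x : ℕ} {l : List ℕ} : x ∈ g l ↔ x ∈ l := by
  have := (S_perm [] l).mem_iff (a := x)
  simpa using this

lemma decomp (m : ℕ) (s : List ℕ) (h : (m :: s).Nodup) :
    ∃ R t, s = R ++ t ∧ (∀ y ∈ R, m < y) ∧ (∀ x ∈ t.head?, x < m) := by
  refine ⟨s.takeWhile (m < ·), s.dropWhile (m < ·), by simp, ?_, ?_⟩
  · intro y hy
    simpa using List.mem_takeWhile_imp hy
  · intro x hx
    have h1 := List.head?_dropWhile_not (fun y => decide (m < y)) s
    rw [Option.mem_def] at hx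
    rw [hx] at h1
    have h2 : x ∈ s := (List.dropWhile_sublist _).subset (List.mem_of_mem_head? hx)
    have h3 : x ≠ m := by rintro rfl; simp [h2] at h
    simp at h1
    omega

lemma split_eq (m : ℕ) (R t : List ℕ) (hR : ∀ y ∈ R, m < y) (ht : ∀ x ∈ t.head?, x < m) :
    (R ++ t).takeWhile (m < ·) = R ∧ (R ++ t).dropWhile (m < ·) = t := by
  induction R with
  | nil =>
    cases t with
    | nil => simp
    | cons x t =>
      have := ht x rfl
      have : ¬ m < x := by omega
      simp [this]
  | cons y R ih =>
    have := ih (fun z hz => hR z (by simp [hz]))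
    have h2 := hR y (by simp)
    simp [h2, this]

lemma g_sorted (R : List ℕ) (h : R.Pairwise (· < ·)) : g R = R.reverse := by
  induction R with
  | nil => exact g_nil
  | cons m R ih =>
    rw [List.pairwise_cons] at h
    have := g_rec m R [] h.1 (by simp)
    rw [List.append_nil] at this
    rw [this, ih h.2, g_nil]; simp

lemma sorted_of_g (n : ℕ) : ∀ R : List ℕ, R.length = n → R.Nodup →
    (∀ a b, [a, b].Sublist (g R) → ¬ a < b) → R.Pairwise (· < ·) := by
  induction n with
  | zero => intro R h; simp at h; simp [h]
  | succ n ih =>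
    rintro (_ | ⟨m, s⟩) hl hn hg
    · simp
    obtain ⟨R, t, rfl, hR, ht⟩ := decomp m s hn
    rw [g_rec m R t hR ht] at hg
    have : t = [] := by
      rcases t with _ | ⟨x, t⟩
      · rfl
      exfalso
      refine hg x m ?_ (ht x rfl)
      refine List.Sublist.trans ?_ (List.sublist_append_right _ _)
      exact List.Sublist.append (l₁ := [x]) (r₁ := [m]) (List.singleton_sublist.2 (mem_g.2 (by simp))) (List.Sublist.refl _)
    subst this
    simp only [List.append_nil] at *
    rw [List.pairwise_cons]
    refine ⟨hR, ih R (by simpa using hl) hn.of_cons ?_⟩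
    intro a b hab
    exact hg a b (hab.trans (List.sublist_append_left _ _))

lemma g_last (m : ℕ) (t : List ℕ) (hn : (m :: t).Nodup) : ∃ s, g (m :: t) = s ++ [m] := by
  obtain ⟨R, t, rfl, hR, ht⟩ := decomp m t hn
  exact ⟨g R ++ g t, by rw [g_rec m R t hR ht]; simp⟩

lemma sub_snoc {a b : ℕ} {u s : List ℕ} (h : (u ++ [a]).Sublist (s ++ [b])) :
    (u ++ [a]).Sublist s ∨ (a = b ∧ u.Sublist s) := by
  have h' := List.reverse_sublist.2 h
  simp only [List.reverse_append, List.reverse_cons, List.reverse_nil, List.nil_append, List.singleton_append] at h'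
  rcases List.cons_sublist_cons'.1 h' with h | ⟨h, h2⟩
  · left
    rw [← List.reverse_sublist]; simpa using h
  · right
    exact ⟨h, List.reverse_sublist.1 h2⟩

lemma av_snoc (m : ℕ) (t : List ℕ) (ht : ∀ x ∈ t.head?, x < m) (hn : t.Nodup) (h : Av (g t)) :
    Av (g t ++ [m]) := by
  intro a b c hs hca hab
  rcases sub_snoc (u := [a, b]) hs with h1 | ⟨rfl, h1⟩
  · exact h a b c h1 hca hab
  · rcases t with _ | ⟨x, t⟩
    · rw [g_nil] at h1; simp at h1
    obtain ⟨s, hs⟩ := g_last x t hn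
    have hx := ht x rfl
    rw [hs] at h h1
    rcases sub_snoc (u := [a]) h1 with h2 | ⟨rfl, h2⟩
    · exact h a b x (List.Sublist.append (l₁ := [a, b]) (r₁ := [x]) h2 (List.Sublist.refl _)) (by omega) hab
    · omega

lemma av_cons (x : ℕ) (s : List ℕ) (hx : ∀ y ∈ s, y < x) (h : Av s) : Av (x :: s) := by
  intro a b c hs hca hab
  rcases List.cons_sublist_cons'.1 hs with h1 | ⟨rfl, h1⟩
  · exact h a b c h1 hca hab
  · have := hx b (h1.subset (by simp)); omega

lemma av_rev (R s : List ℕ) (hR : R.Pairwise (· < ·)) (hs : ∀ a ∈ R, ∀ b ∈ s, b < a) (h : Av s) :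
    Av (R.reverse ++ s) := by
  induction R generalizing s with
  | nil => simpa
  | cons r R ih =>
    rw [List.pairwise_cons] at hR
    have := ih (r :: s) hR.2 ?_ (av_cons r s (hs r (by simp)) h)
    · simpa using this
    · intro a ha b hb
      rcases List.mem_cons.1 hb with rfl | hb
      · exact hR.1 a ha
      · exact hs a (by simp [ha]) b hb

lemma av_of_good (l : List ℕ) (h : Good l) (hn : l.Nodup) : Av (g l) := by
  induction h with
  | nil => rw [g_nil]; intro a b c h; simp at h
  | cons m R t h1 h2 h3 h4 h5 ih =>
    rw [g_rec m R t h1 h2, g_sorted R h3]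
    have hnt : t.Nodup := hn.of_cons.of_append_right
    refine av_rev R _ h3 ?_ (av_snoc m t h2 hnt (ih hnt))
    intro a ha b hb
    rcases List.mem_append.1 hb with hb | hb
    · exact h4 a ha b (mem_g.1 hb)
    · simp at hb; subst hb; exact h1 a ha

lemma good_of_av (n : ℕ) : ∀ l : List ℕ, l.length = n → l.Nodup → Av (g l) → Good l := by
  induction n using Nat.strong_induction_on with
  | _ n ih =>
    rintro (_ | ⟨m, s⟩) hl hn hg
    · exact Good.nil
    obtain ⟨R, t, rfl, hR, ht⟩ := decomp m s hn
    rw [g_rec m R t hR ht] at hg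
    have hnR : R.Nodup := hn.of_cons.of_append_left
    have hnt : t.Nodup := hn.of_cons.of_append_right
    have key : ∀ a b, [a, b].Sublist (g R ++ g t) → m < a → ¬ a < b := by
      intro a b hs hm
      refine hg a b m ?_ hm
      rw [← List.append_assoc]
      exact List.Sublist.append (l₁ := [a, b]) (r₁ := [m]) hs (List.Sublist.refl _)
    refine Good.cons m R t hR ht ?_ ?_ ?_
    · refine sorted_of_g _ R rfl hnR ?_
      intro a b hs
      exact key a b (hs.trans (List.sublist_append_left _ _)) (hR a (mem_g.1 (hs.subset (by simp))))
    · intro a ha b hb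
      have h1 := key a b (List.Sublist.append (l₁ := [a]) (r₁ := [b])
        (List.singleton_sublist.2 (mem_g.2 ha)) (List.singleton_sublist.2 (mem_g.2 hb))) (hR a ha)
      have : a ≠ b := by
        have := List.nodup_append.1 hn.of_cons
        exact this.2.2 a ha b hb
      omega
    · refine ih t.length ?_ t rfl hnt ?_
      · simp at hl; omega
      · intro a b c hs
        exact hg a b c (hs.trans ((List.sublist_append_left _ _).trans (List.sublist_append_right _ _)))

lemma sort_iff (n : ℕ) (τ : List ℕ) : τ ∈ SortSet [1,3,2] {1} n ↔
    (τ.Nodup ∧ τ.toFinset = Finset.Icc 1 n) ∧ Good τ := by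
  have e : IsPermList n τ ↔ τ.Nodup ∧ τ.toFinset = Finset.Icc 1 n := by
    have e0 : (List.range' 1 n).toFinset = Finset.Icc 1 n := by
      ext x; simp [List.mem_range'_1]; omega
    unfold IsPermList
    constructor
    · intro h
      exact ⟨h.nodup_iff.2 List.nodup_range', by rw [← e0]; exact List.toFinset_eq_of_perm _ _ h⟩
    · rintro ⟨h1, h2⟩
      exact List.perm_of_nodup_nodup_toFinset_eq h1 List.nodup_range' (by rw [h2, e0])
  have e2 : ¬ ContainsV [2,3,1] ∅ (sc [1,3,2] {1} τ) ↔ Av (g τ) := by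
    rw [contains231_iff]
    unfold Av sc
    push Not
    rfl
  unfold SortSet
  rw [Set.mem_ofPred_eq, e, e2]
  constructor
  · rintro ⟨h, h2⟩
    exact ⟨h, good_of_av _ τ rfl h.1 h2⟩
  · rintro ⟨h, h2⟩
    exact ⟨h, av_of_good τ h2 h.1⟩

end SC
namespace SC

open Classical in
noncomputable def L (V : Finset ℕ) : Finset (List ℕ) := V.toList.permutations.toFinset.filter Good

open Classical in
lemma mem_L (V : Finset ℕ) (l) : l ∈ L V ↔ (l.Nodup ∧ l.toFinset = V) ∧ Good l := by
  unfold L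
  rw [Finset.mem_filter, List.mem_toFinset, List.mem_permutations]
  refine and_congr_left fun _ => ?_
  constructor
  · intro h
    exact ⟨h.nodup_iff.2 V.nodup_toList, by rw [List.toFinset_eq_of_perm _ _ h, Finset.toList_toFinset]⟩
  · rintro ⟨h1, h2⟩
    exact List.perm_of_nodup_nodup_toFinset_eq h1 V.nodup_toList (by rw [h2, Finset.toList_toFinset])

noncomputable def X (V : Finset ℕ) (m : ℕ) : Finset (List ℕ) := (L V).filter (fun l => l.head? = some m)

def Q (V : Finset ℕ) (m : ℕ) (R t : List ℕ) : Prop :=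
  (∀ y ∈ R, m < y) ∧ (∀ x ∈ t.head?, x < m) ∧ R.Pairwise (· < ·) ∧ (∀ a ∈ R, ∀ b ∈ t, b < a) ∧ Good t ∧
  (m :: (R ++ t)).Nodup ∧ (m :: (R ++ t)).toFinset = V

lemma mem_X (V : Finset ℕ) (m : ℕ) (l) : l ∈ X V m ↔ ∃ R t, l = m :: (R ++ t) ∧ Q V m R t := by
  unfold X
  rw [Finset.mem_filter, mem_L]
  constructor
  · rintro ⟨⟨⟨h1, h2⟩, h3⟩, h4⟩
    cases h3 with
    | nil => simp at h4
    | cons m' R t a1 a2 a3 a4 a5 =>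
      simp at h4; subst h4
      exact ⟨R, t, rfl, a1, a2, a3, a4, a5, h1, h2⟩
  · rintro ⟨R, t, rfl, a1, a2, a3, a4, a5, h1, h2⟩
    exact ⟨⟨⟨h1, h2⟩, Good.cons m R t a1 a2 a3 a4 a5⟩, rfl⟩

lemma Q_max (V : Finset ℕ) (m M : ℕ) (hM : M ∈ V) (hmax : ∀ v ∈ V, v ≤ M) (R t : List ℕ) (hne : R ≠ []) (h : Q V m R t) :
    ∃ R0, R = R0 ++ [M] := by
  obtain ⟨a1, a2, a3, a4, a5, h1, h2⟩ := h
  rcases List.eq_nil_or_concat R with rfl | ⟨R0, z, rfl⟩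
  · simp at hne
  have hz : z ≤ M := hmax z (by rw [← h2]; simp)
  have hz' : M ≤ z := by
    rw [← h2] at hM
    simp only [List.toFinset_cons, List.mem_toFinset, Finset.mem_insert, List.mem_append, List.concat_eq_append] at hM
    rw [List.concat_eq_append, List.pairwise_append] at a3
    rcases hM with rfl | (h | h) | h
    · exact (a1 z (by simp)).le
    · exact (a3.2.2 M h z (by simp)).le
    · simp at h; omega
    · exact (a4 z (by simp) M h).le
  have : z = M := by omega
  subst this
  exact ⟨R0, by simp⟩

lemma Q_iff (V : Finset ℕ) (m M : ℕ) (hM : M ∈ V) (hmax : ∀ v ∈ V, v ≤ M) (R t : List ℕ) :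
    Q V m (R ++ [M]) t ↔ Q (V.erase M) m R t := by
  have hp : (m :: (R ++ [M] ++ t)).Perm (M :: (m :: (R ++ t))) := by
    have := List.perm_middle (a := M) (l₁ := m :: R) (l₂ := t)
    simpa using this
  unfold Q
  rw [hp.nodup_iff, List.toFinset_eq_of_perm _ _ hp, List.nodup_cons]
  constructor
  · rintro ⟨a1, a2, a3, a4, a5, ⟨h0, h1⟩, h2⟩
    refine ⟨fun y hy => a1 y (by simp [hy]), a2, (List.pairwise_append.1 a3).1, fun a ha => a4 a (by simp [ha]), a5, h1, ?_⟩
    rw [← h2, List.toFinset_cons (a := M), Finset.erase_insert]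
    rwa [List.mem_toFinset]
  · rintro ⟨a1, a2, a3, a4, a5, h1, h2⟩
    have hlt : ∀ y ∈ m :: (R ++ t), y < M := by
      intro y hy
      rw [← List.mem_toFinset, h2, Finset.mem_erase] at hy
      have := hmax y hy.2
      have := hy.1
      omega
    refine ⟨?_, a2, ?_, ?_, a5, ⟨fun h => (hlt M h).false, h1⟩, ?_⟩
    · intro y hy
      rcases List.mem_append.1 hy with h | h
      · exact a1 y h
      · simp at h; subst h; exact hlt m (by simp)
    · rw [List.pairwise_append]
      refine ⟨a3, by simp, ?_⟩
      intro a ha b hb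
      simp at hb; subst hb; exact hlt a (by simp [ha])
    · intro a ha b hb
      rcases List.mem_append.1 ha with h | h
      · exact a4 a h b hb
      · simp at h; subst h; exact hlt b (by simp [hb])
    · rw [List.toFinset_cons (a := M), h2, Finset.insert_erase hM]

def ins (m M : ℕ) (l : List ℕ) : List ℕ :=
  m :: (l.tail.takeWhile (m < ·) ++ [M] ++ l.tail.dropWhile (m < ·))

lemma ins_eq (V : Finset ℕ) (m M : ℕ) (R t : List ℕ) (h : Q V m R t) :
    ins m M (m :: (R ++ t)) = m :: (R ++ [M] ++ t) := by
  have := split_eq m R t h.1 h.2.1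
  simp only [ins, List.tail_cons, this.1, this.2]

noncomputable def Y (V : Finset ℕ) (m : ℕ) : Finset (List ℕ) :=
  (L (V.erase m)).filter (fun l => l.headI < m)

lemma X_eq (V : Finset ℕ) (m M : ℕ) (hm : m ∈ V) (hM : M ∈ V) (hmax : ∀ v ∈ V, v ≤ M) (hc : 2 ≤ V.card) :
    X V m = (X (V.erase M) m).image (ins m M) ∪ (Y V m).image (List.cons m) := by
  ext l
  rw [Finset.mem_union, Finset.mem_image, Finset.mem_image, mem_X]
  constructor
  · rintro ⟨R, t, rfl, h⟩
    by_cases hR : R = []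
    · right
      subst hR
      obtain ⟨a1, a2, a3, a4, a5, h1, h2⟩ := h
      refine ⟨t, ?_, rfl⟩
      unfold Y
      rw [Finset.mem_filter, mem_L]
      refine ⟨⟨⟨h1.of_cons, ?_⟩, a5⟩, ?_⟩
      · rw [← h2]
        simp only [List.nil_append, List.toFinset_cons]
        rw [Finset.erase_insert]
        rw [List.mem_toFinset]
        exact (List.nodup_cons.1 h1).1
      · rcases t with _ | ⟨x, t⟩
        · simp at h2; rw [← h2] at hc; simp at hc
        · exact a2 x rfl
    · left
      obtain ⟨R0, rfl⟩ := Q_max V m M hM hmax R t hR h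
      rw [Q_iff V m M hM hmax] at h
      exact ⟨m :: (R0 ++ t), (mem_X _ _ _).2 ⟨R0, t, rfl, h⟩, ins_eq _ _ _ _ _ h⟩
  · rintro (⟨l', h, rfl⟩ | ⟨t, h, rfl⟩)
    · obtain ⟨R, t, rfl, hQ⟩ := (mem_X _ _ _).1 h
      clear h
      have h := hQ
      exact ⟨R ++ [M], t, ins_eq _ _ _ _ _ h, (Q_iff V m M hM hmax _ _).2 h⟩
    · unfold Y at h
      rw [Finset.mem_filter, mem_L] at h
      obtain ⟨⟨⟨h1, h2⟩, h3⟩, h4⟩ := h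
      refine ⟨[], t, rfl, by simp, ?_, by simp, by simp, h3, ?_, ?_⟩
      · intro x hx
        rcases t with _ | ⟨y, t⟩
        · simp at hx
        · simp at hx; subst hx; simpa using h4
      · simp only [List.nil_append]
        refine List.nodup_cons.2 ⟨?_, h1⟩
        rw [← List.mem_toFinset, h2]; simp
      · simp only [List.nil_append, List.toFinset_cons, h2, Finset.insert_erase hm]

lemma X_card (V : Finset ℕ) (m M : ℕ) (hm : m ∈ V) (hM : M ∈ V) (hmax : ∀ v ∈ V, v ≤ M) (hc : 2 ≤ V.card) :
    (X V m).card = (X (V.erase M) m).card + (Y V m).card := by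
  rw [X_eq V m M hm hM hmax hc, Finset.card_union_of_disjoint, Finset.card_image_of_injOn,
    Finset.card_image_of_injective _ (List.cons_injective)]
  · intro l hl l' hl' he
    obtain ⟨R, t, rfl, h⟩ := (mem_X _ _ _).1 hl
    obtain ⟨R', t', rfl, h'⟩ := (mem_X _ _ _).1 hl'
    rw [ins_eq _ _ _ _ _ h, ins_eq _ _ _ _ _ h'] at he
    have he := List.cons_injective he
    have k := (Q_iff V m M hM hmax _ _).2 h
    have k' := (Q_iff V m M hM hmax _ _).2 h'
    have s := split_eq m _ _ k.1 k.2.1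
    have s' := split_eq m _ _ k'.1 k'.2.1
    rw [he] at s
    have e1 : R = R' := List.append_inj_left' (s.1.symm.trans s'.1) rfl
    have e2 : t = t' := s.2.symm.trans s'.2
    rw [e1, e2]
  · rw [Finset.disjoint_left]
    intro l hl hl'
    obtain ⟨l', h, rfl⟩ := Finset.mem_image.1 hl
    obtain ⟨R, t, rfl, hQ⟩ := (mem_X _ _ _).1 h
    clear h
    have h := hQ
    obtain ⟨t', h', he⟩ := Finset.mem_image.1 hl'
    rw [ins_eq _ _ _ _ _ h] at he
    have he := List.cons_injective he
    have k := (Q_iff V m M hM hmax _ _).2 h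
    unfold Y at h'
    have h4 := (Finset.mem_filter.1 h').2
    rw [he] at h4
    rcases R with _ | ⟨r, R⟩
    · have := k.1 M (by simp); simp at h4; omega
    · have := k.1 r (by simp); simp at h4; omega

lemma headI_mem {l : List ℕ} (h : l ≠ []) : l.headI ∈ l ∧ l.head? = some l.headI := by
  cases l with
  | nil => simp at h
  | cons a l => simp

lemma L_ne {V : Finset ℕ} {l} (h : l ∈ L V) (hV : V.Nonempty) : l ≠ [] := by
  rintro rfl
  have := ((mem_L _ _).1 h).1.2
  simp at this
  subst this
  simp at hV

lemma X_eq' (V : Finset ℕ) (hV : V.Nonempty) (m : ℕ) : X V m = (L V).filter (fun l => l.headI = m) := by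
  unfold X
  refine Finset.filter_congr fun l hl => ?_
  rw [(headI_mem (L_ne hl hV)).2]; simp

lemma Y_card (V : Finset ℕ) (m : ℕ) (hm : m ∈ V) (hc : 2 ≤ V.card) :
    (Y V m).card = ∑ v ∈ V.filter (· < m), (X (V.erase m) v).card := by
  have hV : (V.erase m).Nonempty := by
    rw [← Finset.card_pos, Finset.card_erase_of_mem hm]; omega
  rw [Finset.card_eq_sum_card_fiberwise (f := List.headI) (t := V.filter (· < m))]
  · refine Finset.sum_congr rfl fun v hv => ?_
    rw [X_eq' _ hV, Y, Finset.filter_filter]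
    congr 1
    refine Finset.filter_congr fun l hl => ?_
    have := (Finset.mem_filter.1 hv).2
    constructor
    · exact fun h => h.2
    · rintro rfl; exact ⟨this, rfl⟩
  · intro l hl
    have hl := Finset.mem_filter.1 (Finset.mem_coe.1 hl)
    have h1 := (headI_mem (L_ne hl.1 hV)).1
    rw [← List.mem_toFinset, ((mem_L _ _).1 hl.1).1.2] at h1
    exact Finset.mem_coe.2 (Finset.mem_filter.2 ⟨Finset.mem_of_mem_erase h1, hl.2⟩)

lemma L_card (V : Finset ℕ) (hV : V.Nonempty) : (L V).card = ∑ v ∈ V, (X V v).card := by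
  rw [Finset.card_eq_sum_card_fiberwise (f := List.headI) (t := V)]
  · refine Finset.sum_congr rfl fun v hv => ?_
    rw [X_eq' _ hV]
  · intro l hl
    have hl := Finset.mem_coe.1 hl
    have h1 := (headI_mem (L_ne hl hV)).1
    rw [← List.mem_toFinset, ((mem_L _ _).1 hl).1.2] at h1
    exact Finset.mem_coe.2 h1

lemma sum_rank (W : Finset ℕ) (f : ℕ → ℤ) :
    ∑ v ∈ W, f (W.filter (· < v)).card = ∑ j ∈ Finset.range W.card, f j := by
  induction W using Finset.induction_on_max with
  | empty => simp
  | insert a s h ih =>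
    have ha : a ∉ s := fun h' => (h a h').false
    rw [Finset.sum_insert ha, Finset.card_insert_of_notMem ha, Finset.sum_range_succ, ← ih, add_comm]
    congr 1
    · refine Finset.sum_congr rfl fun v hv => ?_
      rw [Finset.filter_insert, if_neg (by have := h v hv; omega)]
    · rw [Finset.filter_insert, if_neg (by omega), Finset.filter_true_of_mem h]

def U (c r : ℕ) : ℤ := (Nat.choose (c + r) c : ℤ) - Nat.choose (c + r) (c + 1)

lemma U_zero (c) : U c 0 = 1 := by simp [U]
lemma U_succ (c r) : U (c+1) (r+1) = U c (r+1) + U (c+1) r := by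
  unfold U
  rw [show c + 1 + (r + 1) = (c + r + 1) + 1 by ring, Nat.choose_succ_succ (c+r+1) c, Nat.choose_succ_succ (c+r+1) (c+1),
    show c + (r + 1) = c + r + 1 by ring, show c + 1 + r = c + r + 1 by ring]
  push_cast
  ring
lemma U_diag (c) : U c (c+1) = 0 := by
  unfold U
  rw [show c + (c + 1) = 2 * c + 1 by ring, Nat.choose_symm_half]; simp
lemma U_sum (c r) : ∑ j ∈ Finset.range (r + 1), U c j = U (c+1) r := by
  induction r with
  | zero => simp [U_zero]
  | succ r ih => rw [Finset.sum_range_succ, ih, U_succ]; ring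
lemma U_catalan (n) : U n n = catalan n := by
  have h := succ_mul_catalan_eq_centralBinom n
  have h2 := Nat.choose_succ_right_eq (n + n) n
  rw [Nat.centralBinom, two_mul] at h
  unfold U
  rw [show n + n - n = n by omega] at h2
  zify at h h2
  have : ((n : ℤ) + 1) ≠ 0 := by positivity
  apply mul_left_cancel₀ this
  linear_combination -h - h2

lemma main (c : ℕ) : ∀ (V : Finset ℕ) (m : ℕ), V.card = c + 1 → m ∈ V →
    ((X V m).card : ℤ) = U c (V.filter (· < m)).card := by
  induction c with
  | zero =>
    intro V m hV hm
    obtain ⟨a, rfl⟩ := Finset.card_eq_one.1 hV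
    simp at hm; subst hm
    have : X {m} m = {[m]} := by
      ext l
      rw [mem_X, Finset.mem_singleton]
      constructor
      · rintro ⟨R, t, rfl, a1, a2, a3, a4, a5, h1, h2⟩
        have := List.toFinset_card_of_nodup h1
        rw [h2] at this
        simp at this
        obtain ⟨rfl, rfl⟩ := this
        rfl
      · rintro rfl
        exact ⟨[], [], rfl, by simp, by simp, by simp, by simp, Good.nil, by simp, by simp⟩
    rw [this]
    simp [Finset.filter_singleton, U_zero]
  | succ c ih =>
    intro V m hV hm
    have hne : V.Nonempty := ⟨m, hm⟩
    obtain ⟨M, hM, hmax⟩ : ∃ M ∈ V, ∀ v ∈ V, v ≤ M := ⟨V.max' hne, V.max'_mem hne, fun v hv => V.le_max' v hv⟩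
    rw [X_card V m M hm hM hmax (by omega), Y_card V m hm (by omega)]
    push_cast
    have e1 : ∑ v ∈ V.filter (· < m), ((X (V.erase m) v).card : ℤ)
        = ∑ j ∈ Finset.range (V.filter (· < m)).card, U c j := by
      rw [← sum_rank]
      refine Finset.sum_congr rfl fun v hv => ?_
      obtain ⟨hv1, hv2⟩ := Finset.mem_filter.1 hv
      rw [ih (V.erase m) v (by rw [Finset.card_erase_of_mem hm]; omega) (Finset.mem_erase.2 ⟨by omega, hv1⟩)]
      congr 2
      ext x
      simp only [Finset.mem_filter, Finset.mem_erase]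
      constructor
      · rintro ⟨⟨_, h⟩, h2⟩; exact ⟨⟨h, by omega⟩, h2⟩
      · rintro ⟨⟨h, _⟩, h2⟩; exact ⟨⟨by omega, h⟩, h2⟩
    have e2 : ((X (V.erase M) m).card : ℤ) = U c (V.filter (· < m)).card := by
      by_cases hmM : m = M
      · subst hmM
        have h0 : X (V.erase m) m = ∅ := by
          rw [Finset.eq_empty_iff_forall_notMem]
          intro l hl
          obtain ⟨R, t, rfl, a1, a2, a3, a4, a5, h1, h2⟩ := (mem_X _ _ _).1 hl
          have : m ∈ V.erase m := by rw [← h2]; simp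
          simp at this
        have h1 : V.filter (· < m) = V.erase m := by
          ext x
          simp only [Finset.mem_filter, Finset.mem_erase]
          constructor
          · rintro ⟨h, h2⟩; exact ⟨by omega, h⟩
          · rintro ⟨h, h2⟩; have := hmax x h2; exact ⟨h2, by omega⟩
        rw [h0, h1, Finset.card_erase_of_mem hm, hV]
        simp [U_diag]
      · rw [ih (V.erase M) m (by rw [Finset.card_erase_of_mem hM]; omega) (Finset.mem_erase.2 ⟨hmM, hm⟩)]
        congr 2
        ext x
        have := hmax m hm
        simp only [Finset.mem_filter, Finset.mem_erase]
        constructor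
        · rintro ⟨⟨_, h⟩, h2⟩; exact ⟨h, h2⟩
        · rintro ⟨h, h2⟩; exact ⟨⟨by omega, h⟩, h2⟩
    rw [e1, e2, ← U_sum, Finset.sum_range_succ, add_comm]

lemma L_catalan (V : Finset ℕ) : (L V).card = catalan V.card := by
  rcases V.eq_empty_or_nonempty with rfl | hV
  · have : L ∅ = {[]} := by
      ext l
      rw [mem_L, Finset.mem_singleton]
      constructor
      · rintro ⟨⟨h, h2⟩, h3⟩; simpa using h2
      · rintro rfl; exact ⟨by simp, Good.nil⟩
    rw [this]; simp
  · obtain ⟨c, hc⟩ : ∃ c, V.card = c + 1 := ⟨V.card - 1, by have := hV.card_pos; omega⟩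
    zify
    rw [L_card V hV, ← U_catalan]
    push_cast
    rw [Finset.sum_congr rfl (fun v hv => main c V v hc hv), sum_rank V (U c), hc, U_sum, U_succ, U_diag, zero_add]

end SC
/-- |Sort_n(sc_{1\un{32}})| = C_n, the n-th Catalan number. -/
theorem card_sortingClass_1un32 (n : ℕ) :
    (SortSet [1, 3, 2] {1} n).ncard = catalan n := by
  have h : SortSet [1, 3, 2] {1} n = ↑(SC.L (Finset.Icc 1 n)) := by
    ext τ
    rw [SC.sort_iff, Finset.mem_coe, SC.mem_L]
  rw [h, Set.ncard_coe_finset, SC.L_catalan]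
  simp
end

section
/- Write a permutation τ ∈ S_n as τ = τ^a n τ^b, where τ^a and τ^b are the subsequences of τ before and after the maximum value n. Then τ belongs to the sorting class of the \underline{12}3-avoiding stack-sorting map if and only if the following three conditions hold: (1) each element of τ^a is greater than each element of τ^b; (2) τ^a avoids the vincular pattern 3\underline{21} and the classical pattern 132; and (3) τ^b avoids the classical pattern 213. -/
theorem cv3 (p q r : ℕ) (A : Set ℕ) (τ : List ℕ) : ContainsV [p,q,r] A τ ↔
    ∃ i j k : Fin τ.length, i < j ∧ j < k ∧
      ((p < q ↔ τ.get i < τ.get j) ∧ (q < p ↔ τ.get j < τ.get i) ∧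
       (p < r ↔ τ.get i < τ.get k) ∧ (r < p ↔ τ.get k < τ.get i) ∧
       (q < r ↔ τ.get j < τ.get k) ∧ (r < q ↔ τ.get k < τ.get j)) ∧
      (0 ∈ A → (j : ℕ) = i + 1) ∧ (1 ∈ A → (k : ℕ) = j + 1) := by
  constructor
  · rintro ⟨f, hf, ho, ha⟩
    refine ⟨f ⟨0, by simp⟩, f ⟨1, by simp⟩, f ⟨2, by simp⟩, hf (by simp), hf (by simp),
      ⟨ho ⟨0, by simp⟩ ⟨1, by simp⟩, ho ⟨1, by simp⟩ ⟨0, by simp⟩, ho ⟨0, by simp⟩ ⟨2, by simp⟩,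
       ho ⟨2, by simp⟩ ⟨0, by simp⟩, ho ⟨1, by simp⟩ ⟨2, by simp⟩, ho ⟨2, by simp⟩ ⟨1, by simp⟩⟩,
      fun h => ha 0 h (by simp), fun h => ha 1 h (by simp)⟩
  · rintro ⟨i, j, k, hij, hjk, ⟨h1, h2, h3, h4, h5, h6⟩, h0, h1'⟩
    refine ⟨(![i, j, k] : Fin 3 → Fin τ.length), ?_, ?_, ?_⟩
    · have hm : StrictMono (![i, j, k] : Fin 3 → Fin τ.length) := by
        intro a b hab
        fin_cases a <;> fin_cases b <;> first | exact hij | exact hjk | exact hij.trans hjk | (exact absurd hab (by decide))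
      exact hm
    · intro a b
      change Fin 3 at a b
      fin_cases a <;> fin_cases b <;> first
        | exact h1 | exact h2 | exact h3 | exact h4 | exact h5 | exact h6
        | exact iff_of_false (lt_irrefl _) (lt_irrefl _)
    · intro a ha h
      have : a < 2 := by simp at h; omega
      interval_cases a
      · exact h0 ha
      · exact h1' ha

theorem sub3 (x y z : ℕ) (τ : List ℕ) : [x,y,z].Sublist τ ↔
    ∃ i j k : Fin τ.length, i < j ∧ j < k ∧ τ.get i = x ∧ τ.get j = y ∧ τ.get k = z := by
  rw [List.sublist_iff_exists_fin_orderEmbedding_get_eq]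
  constructor
  · rintro ⟨f, hf⟩
    refine ⟨f ⟨0, by simp⟩, f ⟨1, by simp⟩, f ⟨2, by simp⟩, by simp, by simp, ?_, ?_, ?_⟩ <;>
    rw [← hf] <;> rfl
  · rintro ⟨i, j, k, hij, hjk, hx, hy, hz⟩
    have hm : StrictMono (![i, j, k] : Fin 3 → Fin τ.length) := by
      intro a b hab
      fin_cases a <;> fin_cases b <;> first | exact hij | exact hjk | exact hij.trans hjk | (exact absurd hab (by decide))
    refine ⟨OrderEmbedding.ofStrictMono _ hm, ?_⟩
    intro a
    change Fin 3 at a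
    fin_cases a
    · exact hx.symm
    · exact hy.symm
    · exact hz.symm

theorem cv231 (τ : List ℕ) : ContainsV [2,3,1] ∅ τ ↔ ∃ x y z, [x,y,z].Sublist τ ∧ z < x ∧ x < y := by
  rw [cv3]
  constructor
  · rintro ⟨i, j, k, hij, hjk, h, -⟩
    exact ⟨_, _, _, (sub3 _ _ _ _).2 ⟨i, j, k, hij, hjk, rfl, rfl, rfl⟩, by omega, by omega⟩
  · rintro ⟨x, y, z, h, h1, h2⟩
    obtain ⟨i, j, k, hij, hjk, rfl, rfl, rfl⟩ := (sub3 _ _ _ _).1 h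
    exact ⟨i, j, k, hij, hjk, by omega, by simp⟩

theorem cv132 (τ : List ℕ) : ContainsV [1,3,2] ∅ τ ↔ ∃ x y z, [x,y,z].Sublist τ ∧ x < z ∧ z < y := by
  rw [cv3]
  constructor
  · rintro ⟨i, j, k, hij, hjk, h, -⟩
    exact ⟨_, _, _, (sub3 _ _ _ _).2 ⟨i, j, k, hij, hjk, rfl, rfl, rfl⟩, by omega, by omega⟩
  · rintro ⟨x, y, z, h, h1, h2⟩
    obtain ⟨i, j, k, hij, hjk, rfl, rfl, rfl⟩ := (sub3 _ _ _ _).1 h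
    exact ⟨i, j, k, hij, hjk, by omega, by simp⟩

theorem cv213 (τ : List ℕ) : ContainsV [2,1,3] ∅ τ ↔ ∃ x y z, [x,y,z].Sublist τ ∧ y < x ∧ x < z := by
  rw [cv3]
  constructor
  · rintro ⟨i, j, k, hij, hjk, h, -⟩
    exact ⟨_, _, _, (sub3 _ _ _ _).2 ⟨i, j, k, hij, hjk, rfl, rfl, rfl⟩, by omega, by omega⟩
  · rintro ⟨x, y, z, h, h1, h2⟩
    obtain ⟨i, j, k, hij, hjk, rfl, rfl, rfl⟩ := (sub3 _ _ _ _).1 h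
    exact ⟨i, j, k, hij, hjk, by omega, by simp⟩

theorem split_at (l : List ℕ) (i : ℕ) (h : i + 1 < l.length) :
    l = l.take i ++ l[i] :: l[i+1] :: l.drop (i+2) := by
  simp

theorem cv123 (τ : List ℕ) : ContainsV [1,2,3] {0} τ ↔
    ∃ p x y q, τ = p ++ x :: y :: q ∧ x < y ∧ ∃ z ∈ q, y < z := by
  rw [cv3]
  constructor
  · rintro ⟨⟨i, hi⟩, ⟨j, hj⟩, ⟨k, hk⟩, hij, hjk, h, h0, -⟩
    simp at hij hjk h h0
    subst h0
    refine ⟨_, _, _, _, split_at τ i hj, by omega, τ[k], ?_, by omega⟩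
    rw [List.mem_iff_getElem]
    exact ⟨k - (i+2), by simp; omega, by simp; congr 1; omega⟩
  · rintro ⟨p, x, y, q, rfl, hxy, z, hz, hyz⟩
    obtain ⟨k, hk, rfl⟩ := List.mem_iff_getElem.1 hz
    refine ⟨⟨p.length, by simp⟩, ⟨p.length + 1, by simp⟩, ⟨p.length + 2 + k, by simp; omega⟩, ?_, ?_, ?_, ?_, ?_⟩
    · simp
    · simp; omega
    · have e3 : (p ++ x :: y :: q)[p.length + 2 + k]'(by simp; omega) = q[k] := by
        rw [List.getElem_append_right (by omega)]
        have : p.length + 2 + k - p.length = k + 2 := by omega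
        simp [this]
      have e2 : (p ++ x :: y :: q)[p.length + 1]'(by simp) = y := by
        rw [List.getElem_append_right (by omega)]
        simp
      have e1 : (p ++ x :: y :: q)[p.length]'(by simp) = x := by
        simp
      simp only [List.get_eq_getElem, e1, e2, e3]
      omega
    · simp
    · simp

theorem cv321 (τ : List ℕ) : ContainsV [3,2,1] {1} τ ↔
    ∃ p x y q, τ = p ++ x :: y :: q ∧ y < x ∧ ∃ z ∈ p, x < z := by
  rw [cv3]
  constructor
  · rintro ⟨⟨k, hk⟩, ⟨i, hi⟩, ⟨j, hj⟩, hij, hjk, h, -, h0⟩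
    simp at hij hjk h h0
    subst h0
    refine ⟨_, _, _, _, split_at τ i hj, by omega, τ[k], ?_, by omega⟩
    rw [List.mem_iff_getElem]
    exact ⟨k, by simp; omega, by simp⟩
  · rintro ⟨p, x, y, q, rfl, hxy, z, hz, hyz⟩
    obtain ⟨k, hk, rfl⟩ := List.mem_iff_getElem.1 hz
    refine ⟨⟨k, by simp; omega⟩, ⟨p.length, by simp⟩, ⟨p.length + 1, by simp⟩, ?_, ?_, ?_, ?_, ?_⟩
    · simp; omega
    · simp
    · have e3 : (p ++ x :: y :: q)[k]'(by simp; omega) = p[k] := by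
        rw [List.getElem_append_left]
      have e2 : (p ++ x :: y :: q)[p.length + 1]'(by simp) = y := by
        rw [List.getElem_append_right (by omega)]
        simp
      have e1 : (p ++ x :: y :: q)[p.length]'(by simp) = x := by
        simp
      simp only [List.get_eq_getElem, e1, e2, e3]
      omega
    · simp
    · simp

def Good (l : List ℕ) : Prop := ¬ ContainsV [1,2,3] {0} l

theorem good_reverse (a : List ℕ) : Good a.reverse ↔ ¬ ContainsV [3,2,1] {1} a := by
  rw [Good, cv123, cv321, not_iff_not]
  constructor
  · rintro ⟨p, x, y, q, h, hxy, z, hz, hyz⟩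
    refine ⟨q.reverse, y, x, p.reverse, ?_, hxy, z, by simpa using hz, hyz⟩
    rw [← List.reverse_reverse a, h]; simp
  · rintro ⟨p, x, y, q, rfl, hxy, z, hz, hyz⟩
    exact ⟨q.reverse, y, x, p.reverse, by simp, hxy, z, by simpa using hz, hyz⟩

theorem good_tail {x : ℕ} {l : List ℕ} (h : Good (x :: l)) : Good l := by
  intro hc
  rw [cv123] at hc
  obtain ⟨p, y, z, q, rfl, h'⟩ := hc
  exact h ((cv123 _).2 ⟨x :: p, y, z, q, rfl, h'⟩)

theorem good_suffix {s t : List ℕ} (h : Good (s ++ t)) : Good t := by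
  induction s with
  | nil => exact h
  | cons x s ih => exact ih (good_tail h)

theorem good_cons_iff (x y : ℕ) (s : List ℕ) :
    Good (x :: y :: s) ↔ Good (y :: s) ∧ (x < y → ∀ z ∈ s, z ≤ y) := by
  constructor
  · intro h
    refine ⟨good_tail h, fun hxy z hz => ?_⟩
    by_contra hc
    exact h ((cv123 _).2 ⟨[], x, y, s, rfl, hxy, z, hz, by omega⟩)
  · rintro ⟨h, h'⟩ hc
    rw [cv123] at hc
    obtain ⟨p, u, v, q, he, huv, z, hz, hvz⟩ := hc
    cases p with
    | nil =>
      simp at he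
      obtain ⟨rfl, rfl, rfl⟩ := he
      have := h' huv z hz
      omega
    | cons w p =>
      simp at he
      exact h ((cv123 _).2 ⟨p, u, v, q, he.2, huv, z, hz, hvz⟩)

theorem good_nil : Good [] := by
  rw [Good, cv123]; rintro ⟨p, u, v, q, he, -⟩; simp at he

theorem good_single (x : ℕ) : Good [x] := by
  rw [Good, cv123]; rintro ⟨p, u, v, q, he, -⟩
  have := congrArg List.length he
  simp at this
  omega

theorem good_max {n : ℕ} {s : List ℕ} (h : Good s) (hn : ∀ x ∈ s, x < n) : Good (n :: s) := by
  cases s with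
  | nil => exact good_single n
  | cons y s =>
    rw [good_cons_iff]
    refine ⟨h, fun h => ?_⟩
    have := hn y (by simp)
    omega

theorem good_desc {n : ℕ} {t : List ℕ} (h : Good (n :: t)) (hn : ∀ x ∈ t, x < n) :
    ∀ S : List ℕ, S.Pairwise (· ≥ ·) → Good (S ++ n :: t) := by
  intro S
  induction S with
  | nil => intro _; exact h
  | cons x S ih =>
    intro hS
    rw [List.pairwise_cons] at hS
    have := ih hS.2
    cases S with
    | nil =>
      simp only [List.cons_append, List.nil_append] at *
      rw [good_cons_iff]
      exact ⟨this, fun _ z hz => (hn z hz).le⟩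
    | cons y S =>
      simp only [List.cons_append] at *
      rw [good_cons_iff]
      refine ⟨this, fun h => ?_⟩
      have := hS.1 y (by simp)
      omega

noncomputable abbrev F := scAux [1,2,3] {0}

theorem F_nil (s : List ℕ) : F s [] = s := by simp [F, scAux]
theorem F_push {x : ℕ} {s r : List ℕ} (h : Good (x :: s)) : F s (x :: r) = F (x :: s) r := by
  cases s with
  | nil => simp [F, scAux]
  | cons y s => rw [F, scAux, if_neg h]
theorem F_pop {x y : ℕ} {s r : List ℕ} (h : ¬ Good (x :: y :: s)) :
    F (y :: s) (x :: r) = y :: F s (x :: r) := by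
  rw [F, scAux, if_pos (not_not.1 h)]

theorem F_pushes (l r : List ℕ) : ∀ s, Good (l.reverse ++ s) → F s (l ++ r) = F (l.reverse ++ s) r := by
  induction l with
  | nil => intro s _; rfl
  | cons x l ih =>
    intro s h
    simp only [List.reverse_cons, List.append_assoc, List.cons_append, List.nil_append] at *
    rw [F_push (good_suffix h), ih _ h]

def W : List ℕ → List ℕ → List ℕ
  | S, [] => S
  | [], x :: r => W [x] r
  | y :: S, x :: r => if x < y then y :: W S (x :: r) else W (x :: y :: S) r
termination_by S b => S.length + 2 * b.length
decreasing_by all_goals (simp only [List.length_cons, List.length_nil]; omega)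

theorem F_W {n : ℕ} {t : List ℕ} (h : Good (n :: t)) (hn : ∀ x ∈ t, x < n) (S b : List ℕ)
    (hS : S.Pairwise (· ≥ ·)) (hSn : ∀ x ∈ S, x < n) (hb : ∀ x ∈ b, x < n) :
    F (S ++ n :: t) b = W S b ++ n :: t := by
  induction S, b using W.induct with
  | case1 S => simp [F_nil, W]
  | case2 x r ih =>
    rw [W, ← ih (by simp) (by simpa using hb x (by simp)) (fun z hz => hb z (by simp [hz]))]
    exact F_push (good_desc h hn [x] (by simp))
  | case3 y S x r hxy ih =>
    rw [W, if_pos hxy, List.cons_append, List.cons_append, F_pop,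
      ih (List.pairwise_cons.1 hS).2 (fun z hz => hSn z (by simp [hz])) hb]
    rw [good_cons_iff]
    rintro ⟨-, h2⟩
    have := h2 hxy n (by simp)
    have := hSn y (by simp)
    omega
  | case4 y S x r hxy ih =>
    have hp : (x :: y :: S).Pairwise (· ≥ ·) := by
      rw [List.pairwise_cons]
      refine ⟨fun z hz => ?_, hS⟩
      rcases List.mem_cons.1 hz with rfl | hz
      · omega
      · have := (List.pairwise_cons.1 hS).1 z hz
        omega
    rw [W, if_neg hxy, ← ih hp ?_ (fun z hz => hb z (by simp [hz]))]
    · exact F_push (good_desc h hn _ hp)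
    · intro z hz
      rcases List.mem_cons.1 hz with rfl | hz
      · exact hb _ (by simp)
      · exact hSn z hz

theorem W_perm (S b : List ℕ) : (W S b).Perm (S ++ b) := by
  induction S, b using W.induct with
  | case1 S => simp [W]
  | case2 x r ih => rw [W]; simpa using ih
  | case3 y S x r hxy ih => rw [W, if_pos hxy]; simpa using ih
  | case4 y S x r hxy ih =>
    rw [W, if_neg hxy]
    exact ih.trans (List.perm_middle (l₁ := y :: S)).symm

theorem W_last (S b : List ℕ) (hS : S.Pairwise (· ≥ ·)) (hne : S ++ b ≠ []) :
    ∃ u m, W S b = u ++ [m] ∧ ∀ x ∈ S ++ b, m ≤ x := by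
  induction S, b using W.induct with
  | case1 S =>
    rw [W]
    have hS' : S ≠ [] := by simpa using hne
    refine ⟨S.dropLast, S.getLast hS', (List.dropLast_append_getLast hS').symm, ?_⟩
    rw [← List.dropLast_append_getLast hS', List.pairwise_append] at hS
    intro x hx
    rw [List.append_nil, ← List.dropLast_append_getLast hS', List.mem_append] at hx
    rcases hx with hx | hx
    · exact hS.2.2 x hx _ (by simp)
    · simp at hx; omega
  | case2 x r ih => rw [W]; simpa using ih
  | case3 y S x r hxy ih =>
    rw [W, if_pos hxy]
    obtain ⟨u, m, h, hm⟩ := ih (List.pairwise_cons.1 hS).2 (by simp)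
    refine ⟨y :: u, m, by simp [h], ?_⟩
    intro z hz
    rcases List.mem_cons.1 hz with rfl | hz
    · have := hm x (by simp); omega
    · exact hm z hz
  | case4 y S x r hxy ih =>
    have hp : (x :: y :: S).Pairwise (· ≥ ·) := by
      rw [List.pairwise_cons]
      refine ⟨fun z hz => ?_, hS⟩
      rcases List.mem_cons.1 hz with rfl | hz
      · omega
      · have := (List.pairwise_cons.1 hS).1 z hz
        omega
    rw [W, if_neg hxy]
    obtain ⟨u, m, h, hm⟩ := ih hp (by simp)
    refine ⟨u, m, h, fun z hz => hm z ?_⟩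
    simp at hz ⊢; tauto

def Q (S b : List ℕ) : Prop :=
  (∀ y ∈ S, ∀ x z, [x,z].Sublist b → x < y → z ≤ y) ∧
    ∀ y x z, [y,x,z].Sublist b → x < y → z ≤ y

theorem sub2_cons (x z w : ℕ) (r : List ℕ) :
    [x,z].Sublist (w :: r) ↔ [x,z].Sublist r ∨ (x = w ∧ z ∈ r) := by
  rw [List.sublist_cons_iff]; simp
theorem sub3_cons (y x z w : ℕ) (r : List ℕ) :
    [y,x,z].Sublist (w :: r) ↔ [y,x,z].Sublist r ∨ (y = w ∧ [x,z].Sublist r) := by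
  rw [List.sublist_cons_iff]; simp
theorem sub2_mem {x z : ℕ} {r : List ℕ} (h : [x,z].Sublist r) : x ∈ r ∧ z ∈ r :=
  ⟨h.subset (by simp), h.subset (by simp)⟩

theorem W_sorted (S b : List ℕ) (hS : S.Pairwise (· ≥ ·)) :
    (W S b).Pairwise (· ≥ ·) ↔ Q S b := by
  induction S, b using W.induct with
  | case1 S => simp [W, Q, hS]
  | case2 x r ih =>
    rw [W, ih (by simp)]
    simp only [Q, sub3_cons, List.mem_singleton, List.not_mem_nil]
    grind
  | case3 y S x r hxy ih =>
    rw [W, if_pos hxy, List.pairwise_cons, ih (List.pairwise_cons.1 hS).2]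
    have hp := W_perm S (x :: r)
    simp only [hp.mem_iff]
    have := (List.pairwise_cons.1 hS).1
    simp only [Q, sub2_cons, sub3_cons, List.mem_append, List.mem_cons]
    have h2 := fun x z => @sub2_mem x z r
    constructor
    · rintro ⟨h1, h3, h4⟩
      refine ⟨?_, h4⟩
      rintro y' (rfl | hy') x' z' h hlt
      · apply h1; rcases h with h | h
        · exact Or.inr (Or.inr (h2 _ _ h).2)
        · exact Or.inr (Or.inr h.2)
      · exact h3 y' hy' x' z' h hlt
    · rintro ⟨h3, h4⟩
      refine ⟨?_, fun y' hy' => h3 y' (Or.inr hy'), h4⟩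
      rintro z (hz | rfl | hz)
      · exact this z hz
      · omega
      · exact h3 y (Or.inl rfl) x z (Or.inr ⟨rfl, hz⟩) hxy
  | case4 y S x r hxy ih =>
    have hp : (x :: y :: S).Pairwise (· ≥ ·) := by
      rw [List.pairwise_cons]
      refine ⟨fun z hz => ?_, hS⟩
      rcases List.mem_cons.1 hz with rfl | hz
      · omega
      · have := (List.pairwise_cons.1 hS).1 z hz
        omega
    rw [W, if_neg hxy, ih hp]
    have hx := (List.pairwise_cons.1 hp).1
    unfold Q
    constructor
    · rintro ⟨h1, h2⟩
      constructor
      · intro y' hy' x' z' h hlt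
        rw [sub2_cons] at h
        rcases h with h | ⟨rfl, h⟩
        · exact h1 y' (by simp at hy' ⊢; tauto) _ _ h hlt
        · have := hx y' hy'; omega
      · intro y' x' z' h hlt
        rw [sub3_cons] at h
        rcases h with h | ⟨rfl, h⟩
        · exact h2 _ _ _ h hlt
        · exact h1 _ (by simp) _ _ h hlt
    · rintro ⟨h1, h2⟩
      constructor
      · intro y' hy' x' z' h hlt
        rcases List.mem_cons.1 hy' with rfl | hy'
        · exact h2 _ _ _ ((sub3_cons _ _ _ _ _).2 (Or.inr ⟨rfl, h⟩)) hlt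
        · exact h1 y' hy' _ _ ((sub2_cons _ _ _ _).2 (Or.inl h)) hlt
      · intro y' x' z' h hlt
        exact h2 _ _ _ ((sub3_cons _ _ _ _ _).2 (Or.inl h)) hlt

theorem W_231 (b : List ℕ) (hb : b.Nodup) :
    (¬ ContainsV [2,3,1] ∅ (W [] b)) ↔ ¬ ContainsV [2,1,3] ∅ b := by
  have hs := W_sorted [] b (by simp)
  have hnd : (W [] b).Nodup := (W_perm [] b).nodup_iff.2 (by simpa using hb)
  have e1 : Q [] b ↔ ¬ ContainsV [2,1,3] ∅ b := by
    rw [cv213]; simp [Q]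
  rw [← e1, ← hs, cv231]
  constructor
  · intro h
    by_cases hne : b = []
    · subst hne; simp [W]
    obtain ⟨u, m, hu, hm⟩ := W_last [] b (by simp) (by simpa using hne)
    have hm' : ∀ x ∈ u, m < x := by
      intro x hx
      have h1 : x ∈ W [] b := by rw [hu]; simp [hx]
      have h2 := hm x ((W_perm [] b).mem_iff.1 h1)
      rw [hu, List.nodup_append] at hnd
      have := hnd.2.2 x hx m (by simp)
      omega
    rw [hu, List.pairwise_append]
    refine ⟨?_, by simp, fun x hx y hy => by simp at hy; have := hm' x hx; omega⟩
    rw [List.pairwise_iff_forall_sublist]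
    intro x y hxy
    by_contra hc
    refine h ⟨x, y, m, ?_, hm' x (hxy.subset (by simp)), by omega⟩
    rw [hu]
    exact hxy.append (List.Sublist.refl [m])
  · rintro h ⟨x, y, z, hsub, h1, h2⟩
    have := (h.sublist hsub)
    simp at this
    omega

theorem F_min {n : ℕ} (a b : List ℕ) (hb : ∀ x ∈ b, x < n) (ha : ∀ x ∈ a, x < n) :
    ∀ s, Good s → (∀ x ∈ s, x < n) → ∀ m ∈ s ++ a, ∃ m', m' ≤ m ∧ [n,m'].Sublist (F s (a ++ n :: b)) := by
  induction a with
  | nil =>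
    intro s hs hsn m hm
    refine ⟨m, le_rfl, ?_⟩
    have hg := good_max hs hsn
    rw [List.nil_append, F_push hg]
    have := F_W hg hsn [] b (by simp) (by simp) hb
    simp only [List.nil_append] at this
    rw [this]
    refine List.Sublist.trans ?_ (List.sublist_append_right _ _)
    simpa using hm
  | cons x a ih =>
    have ih := ih (fun z hz => ha z (by simp [hz]))
    intro s
    have push : ∀ s, Good (x :: s) → (∀ x ∈ s, x < n) → ∀ m ∈ s ++ x :: a,
      ∃ m', m' ≤ m ∧ [n,m'].Sublist (F s (x :: a ++ n :: b)) := by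
      intro s hg hsn m hm
      rw [List.cons_append, F_push hg]
      apply ih _ hg
      · intro z hz
        rcases List.mem_cons.1 hz with rfl | hz
        · exact ha _ (by simp)
        · exact hsn z hz
      · simp at hm ⊢; tauto
    induction s with
    | nil => intro hs; exact push [] (good_single x)
    | cons y s ihs =>
      intro hs hsn m hm
      by_cases hg : Good (x :: y :: s)
      · exact push _ hg hsn m hm
      · have hlt : x < y := by
          by_contra hc
          exact hg ((good_cons_iff _ _ _).2 ⟨hs, fun h => absurd h hc⟩)
        rw [List.cons_append, F_pop hg]
        have ihs := ihs (good_tail hs) (fun z hz => hsn z (by simp [hz]))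
        rw [List.cons_append, List.mem_cons] at hm
        rcases hm with rfl | hm
        · obtain ⟨m', h1, h2⟩ := ihs x (by simp)
          exact ⟨m', by omega, h2.cons _⟩
        · obtain ⟨m', h1, h2⟩ := ihs m hm
          exact ⟨m', by omega, h2.cons _⟩

theorem F_dich {n : ℕ} (a b : List ℕ) (hb : ∀ x ∈ b, x < n) (ha : ∀ x ∈ a, x < n) :
    ∀ s, Good s → (∀ x ∈ s, x < n) → Good (a.reverse ++ s) ∨
      ∃ d m, m < d ∧ d < n ∧ [d,n,m].Sublist (F s (a ++ n :: b)) := by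
  induction a with
  | nil => intro s hs _; exact Or.inl hs
  | cons x a ih =>
    intro s hs hsn
    by_cases hg : Good (x :: s)
    · have := ih (fun z hz => ha z (by simp [hz])) (x :: s) hg ?_
      · rw [List.cons_append, F_push hg]; simpa using this
      · intro z hz
        rcases List.mem_cons.1 hz with rfl | hz
        · exact ha _ (by simp)
        · exact hsn z hz
    · right
      cases s with
      | nil => exact absurd (good_single x) hg
      | cons y s =>
        have hlt : x < y := by
          by_contra hc
          exact hg ((good_cons_iff _ _ _).2 ⟨hs, fun h => absurd h hc⟩)
        obtain ⟨m', h1, h2⟩ := F_min (x :: a) b hb ha s (good_tail hs) (fun z hz => hsn z (by simp [hz])) x (by simp)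
        refine ⟨y, m', by omega, hsn y (by simp), ?_⟩
        rw [List.cons_append, F_pop hg]
        exact h2.cons_cons y

theorem cv231_reverse (a : List ℕ) : ContainsV [2,3,1] ∅ a.reverse ↔ ContainsV [1,3,2] ∅ a := by
  rw [cv231, cv132]
  constructor
  · rintro ⟨x, y, z, h, h1, h2⟩
    exact ⟨z, y, x, by simpa using h.reverse, h1, h2⟩
  · rintro ⟨x, y, z, h, h1, h2⟩
    exact ⟨z, y, x, by simpa using h.reverse, h1, h2⟩

theorem cv231_join {n : ℕ} (u t : List ℕ) (hu : ∀ x ∈ u, x < n) (ht : ∀ x ∈ t, x < n)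
    (hne : ∀ x ∈ u, ∀ y ∈ t, x ≠ y) :
    (¬ ContainsV [2,3,1] ∅ (u ++ n :: t)) ↔
      (∀ y ∈ t, ∀ x ∈ u, x < y) ∧ (¬ ContainsV [2,3,1] ∅ t) ∧ ¬ ContainsV [2,3,1] ∅ u := by
  simp only [cv231]
  constructor
  · intro h
    refine ⟨?_, ?_, ?_⟩
    · intro y hy x hx
      by_contra hc
      have := hne x hx y hy
      refine h ⟨x, n, y, ?_, by omega, hu x hx⟩
      exact (List.singleton_sublist.2 hx).append ((List.singleton_sublist.2 hy).cons_cons n)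
    · rintro ⟨x, y, z, hs, h'⟩
      exact h ⟨x, y, z, (hs.cons n).trans (List.sublist_append_right _ _), h'⟩
    · rintro ⟨x, y, z, hs, h'⟩
      exact h ⟨x, y, z, hs.trans (List.sublist_append_left _ _), h'⟩
  · rintro ⟨h1, h2, h3⟩ ⟨x, y, z, hs, hzx, hxy⟩
    have hmax : ∀ w ∈ u ++ n :: t, w ≤ n := by
      intro w hw
      simp at hw
      rcases hw with hw | rfl | hw
      · exact (hu w hw).le
      · exact le_rfl
      · exact (ht w hw).le
    have hyn := hmax y (hs.subset (by simp))
    have hT : ∀ w w', [w, w'].Sublist (n :: t) → w' ∈ t := by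
      intro w w' h
      rcases (sub2_cons _ _ _ _).1 h with h | h
      · exact (sub2_mem h).2
      · exact h.2
    rw [List.sublist_append_iff] at hs
    obtain ⟨l1, l2, he, hl1, hl2⟩ := hs
    match l1, he with
    | [], he =>
      simp at he; subst he
      rcases (sub3_cons _ _ _ _ _).1 hl2 with h | ⟨rfl, h⟩
      · exact h2 ⟨x, y, z, h, hzx, hxy⟩
      · omega
    | [_], he =>
      simp at he; obtain ⟨rfl, rfl⟩ := he
      have := h1 z (hT _ _ hl2) x (by simpa using hl1)
      omega
    | [_, _], he =>
      simp at he; obtain ⟨rfl, rfl, rfl⟩ := he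
      have hz : z ∈ n :: t := by simpa using hl2
      have hx := (sub2_mem hl1).1
      rcases List.mem_cons.1 hz with rfl | hz
      · omega
      · have := h1 z hz x hx
        omega
    | [_, _, _], he =>
      simp at he; obtain ⟨rfl, rfl, rfl, rfl⟩ := he
      exact h3 ⟨x, y, z, hl1, hzx, hxy⟩
    | _ :: _ :: _ :: _ :: _, he => simp at he

/-- Writing τ = τᵃ n τᵇ, we have τ ∈ Sort_n(sc_{\un{12}3}) iff (1) every element of τᵃ
exceeds every element of τᵇ, (2) τᵃ ∈ Av(3\un{21}, 132), and (3) τᵇ ∈ Av(213). -/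
theorem sortingClass_un123_characterization (n : ℕ) (hn : 1 ≤ n) (τ a b : List ℕ)
    (hτ : IsPermList n τ) (hab : τ = a ++ n :: b) :
    τ ∈ SortSet [1, 2, 3] {0} n ↔
      ((∀ x ∈ a, ∀ y ∈ b, y < x) ∧
        (¬ ContainsV [3, 2, 1] {1} a ∧ ¬ ContainsV [1, 3, 2] ∅ a) ∧
        ¬ ContainsV [2, 1, 3] ∅ b) := by
  have hnd : (a ++ n :: b).Nodup := by
    rw [← hab]; exact hτ.nodup_iff.2 List.nodup_range'
  have hle : ∀ x ∈ a ++ n :: b, x ≤ n := by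
    intro x hx
    rw [← hab] at hx
    have := hτ.mem_iff.1 hx
    rw [List.mem_range'_1] at this
    omega
  rw [List.nodup_append, List.nodup_cons] at hnd
  obtain ⟨hna, ⟨hnb, hbn⟩, hdis⟩ := hnd
  have ha : ∀ x ∈ a, x < n := fun x hx =>
    lt_of_le_of_ne (hle x (by simp [hx])) (hdis x hx n (by simp))
  have hb : ∀ x ∈ b, x < n := fun x hx =>
    lt_of_le_of_ne (hle x (by simp [hx])) (fun h => hnb (h ▸ hx))
  have hmem : τ ∈ SortSet [1, 2, 3] {0} n ↔ ¬ ContainsV [2, 3, 1] ∅ (F [] (a ++ n :: b)) := by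
    rw [← hab]
    exact ⟨fun h => h.2, fun h => ⟨hτ, h⟩⟩
  rw [hmem, ← good_reverse]
  by_cases hg : Good a.reverse
  · have har : ∀ x ∈ a.reverse, x < n := by simpa using ha
    have hg' := good_max hg har
    have e : F [] (a ++ n :: b) = W [] b ++ n :: a.reverse := by
      rw [F_pushes a _ [] (by simpa using hg), List.append_nil, F_push hg']
      exact F_W hg' har [] b (by simp) (by simp) hb
    have hW : ∀ x, x ∈ W [] b ↔ x ∈ b := fun x => by simpa using (W_perm [] b).mem_iff (a := x)
    rw [e, cv231_join, cv231_reverse, W_231 b hbn]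
    · simp only [hW, List.mem_reverse, hg, true_and]
    · simpa only [hW] using hb
    · exact har
    · intro x hx y hy
      rw [hW] at hx
      rw [List.mem_reverse] at hy
      exact (hdis y hy x (by simp [hx])).symm
  · refine iff_of_false ?_ (fun h => hg h.2.1.1)
    rcases F_dich a b hb ha [] good_nil (by simp) with h | ⟨d, m, h1, h2, h3⟩
    · exact absurd (by simpa using h) hg
    · exact not_not.2 ((cv231 _).2 ⟨d, n, m, h3, h1, h2⟩)
end
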